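/- arXiv:2512.11704 — 8 statements merged into one kernel-verified Lean document; each statement's English description precedes it below -/
import Mathlib

section
/- For every element w of the free group F₂ on two generators there exists a polynomial P ∈ ℤ[u,v,t] in three variables such that for every commutative ring R and all matrices X, Y ∈ SL(2,R), the trace of the image of w under the group homomorphism F₂ → SL(2,R) sending the first generator to X and the second to Y equals the evaluation P(tr X, tr Y, tr(X·Y)). -/
open Matrix in
/-- The Cayley–Hamilton theorem for `2 × 2` matrices of determinant one. -/
theorem Matrix.mul_self_eq_trace_smul_sub_one {R : Type*} [CommRing R]
    {A : Matrix (Fin 2) (Fin 2) R} (hA : A.det = 1) : A * A = A.trace • A - 1 := by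
  rw [det_fin_two] at hA
  ext i j
  fin_cases i <;> fin_cases j <;> simp [mul_apply, trace_fin_two] <;>
    first | ring1 | linear_combination -hA

/-- The polarized Cayley–Hamilton theorem for `2 × 2` matrices. -/
theorem Matrix.mul_comm_fin_two {R : Type*} [CommRing R] (A B : Matrix (Fin 2) (Fin 2) R) :
    B * A = ((A * B).trace - A.trace * B.trace) • 1 + B.trace • A + A.trace • B - A * B := by
  ext i j
  fin_cases i <;> fin_cases j <;> simp [Matrix.mul_apply, trace_fin_two] <;> ring

theorem Matrix.mul_mul_mul_fin_two {R : Type*} [CommRing R] {A B : Matrix (Fin 2) (Fin 2) R}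
    (hB : B.det = 1) :
    B * (A * B) = -A.trace • 1 + A + (A * B).trace • B := by
  rw [← Matrix.mul_assoc, Matrix.mul_comm_fin_two A B, sub_mul, add_mul, add_mul, Matrix.mul_assoc A]
  simp only [smul_mul_assoc, mul_self_eq_trace_smul_sub_one hB, mul_sub, mul_smul_comm, one_mul,
    mul_one]
  module

theorem Matrix.SpecialLinearGroup.coe_inv_eq_trace_smul_one_sub {R : Type*} [CommRing R]
    (A : Matrix.SpecialLinearGroup (Fin 2) R) :
    (↑A⁻¹ : Matrix (Fin 2) (Fin 2) R) = (A : Matrix (Fin 2) (Fin 2) R).trace • 1 - A.1 := by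
  rw [Matrix.SpecialLinearGroup.coe_inv, Matrix.adjugate_fin_two]
  ext i j
  fin_cases i <;> fin_cases j <;> simp [Matrix.trace_fin_two]

/-- Evaluation of a polynomial in three variables at the traces of `X`, `Y` and `X * Y`. -/
noncomputable def traceEval {R : Type*} [CommRing R]
    (X Y : Matrix.SpecialLinearGroup (Fin 2) R) : MvPolynomial (Fin 3) ℤ →ₐ[ℤ] R :=
  MvPolynomial.aeval
    ![Matrix.trace (X : Matrix (Fin 2) (Fin 2) R),
      Matrix.trace (Y : Matrix (Fin 2) (Fin 2) R),
      Matrix.trace ((X * Y : Matrix.SpecialLinearGroup (Fin 2) R) : Matrix (Fin 2) (Fin 2) R)]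

section

variable {R : Type*} [CommRing R] (X Y : Matrix.SpecialLinearGroup (Fin 2) R)

@[simp]
theorem traceEval_X_zero : traceEval X Y (MvPolynomial.X 0) = X.1.trace := by
  simp [traceEval]

@[simp]
theorem traceEval_X_one : traceEval X Y (MvPolynomial.X 1) = Y.1.trace := by
  simp [traceEval]

@[simp]
theorem traceEval_X_two : traceEval X Y (MvPolynomial.X 2) = (X.1 * Y.1).trace := by
  simp [traceEval]

end

open MvPolynomial in
/-- Every word in `X, Y ∈ SL(2, R)` is a combination of `1`, `X`, `Y` and `X * Y` whose coefficients
are universal integral polynomials in the traces of `X`, `Y` and `X * Y`. -/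
theorem exists_word_eq_combination (w : FreeGroup (Fin 2)) :
    ∃ a b c d : MvPolynomial (Fin 3) ℤ,
      ∀ (R : Type*) [CommRing R] (X Y : Matrix.SpecialLinearGroup (Fin 2) R),
        (FreeGroup.lift ![X, Y] w).1 = traceEval X Y a • 1 + traceEval X Y b • X.1
          + traceEval X Y c • Y.1 + traceEval X Y d • (X.1 * Y.1) := by
  have hw : w ∈ Subgroup.closure (Set.range (FreeGroup.of : Fin 2 → FreeGroup (Fin 2))) := by
    simp [FreeGroup.closure_range_of]
  induction hw using Subgroup.closure_induction_left with
  | one => exact ⟨1, 0, 0, 0, fun R _ X Y => by simp⟩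
  | mul_left x hx y hy ih =>
    obtain ⟨i, rfl⟩ := hx
    obtain ⟨a, b, c, d, h⟩ := ih
    fin_cases i
    · refine ⟨-b, a + X 0 * b, -d, c + X 0 * d, fun R _ A B => ?_⟩
      simp [h, mul_add, ← Matrix.mul_assoc, Matrix.mul_self_eq_trace_smul_sub_one A.2, sub_mul]
      module
    · refine ⟨(X 2 - X 0 * X 1) * b - c - X 0 * d, X 1 * b + d, a + X 0 * b + X 1 * c + X 2 * d,
        -b, fun R _ A B => ?_⟩
      simp [h, mul_add, Matrix.mul_self_eq_trace_smul_sub_one B.2,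
        Matrix.mul_comm_fin_two A.1 B.1, Matrix.mul_mul_mul_fin_two B.2]
      module
  | inv_mul_cancel x hx y hy ih =>
    obtain ⟨i, rfl⟩ := hx
    obtain ⟨a, b, c, d, h⟩ := ih
    fin_cases i
    · refine ⟨X 0 * a + b, -a, X 0 * c + d, -c, fun R _ A B => ?_⟩
      simp [h, -Matrix.SpecialLinearGroup.coe_inv,
        Matrix.SpecialLinearGroup.coe_inv_eq_trace_smul_one_sub, sub_mul, mul_add,
        ← Matrix.mul_assoc, Matrix.mul_self_eq_trace_smul_sub_one A.2]
      module
    · refine ⟨X 1 * a - ((X 2 - X 0 * X 1) * b - c - X 0 * d), -d,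
        -a - X 0 * b - X 2 * d, X 1 * d + b, fun R _ A B => ?_⟩
      simp [h, -Matrix.SpecialLinearGroup.coe_inv,
        Matrix.SpecialLinearGroup.coe_inv_eq_trace_smul_one_sub, sub_mul, mul_add,
        Matrix.mul_self_eq_trace_smul_sub_one B.2,
        Matrix.mul_comm_fin_two A.1 B.1, Matrix.mul_mul_mul_fin_two B.2]
      module

/-- **Trace polynomial for words in two `SL(2)` matrices.**
For every element `w` of the free group on two generators there exists a polynomial
`P ∈ ℤ[u,v,t]` such that for every commutative ring `R` and all `X Y ∈ SL(2,R)`,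
the trace of the image of `w` under the homomorphism sending the generators to `X, Y`
equals `P (tr X) (tr Y) (tr (X*Y))`. -/
theorem trace_word_eq_trace_polynomial :
    ∀ w : FreeGroup (Fin 2), ∃ P : MvPolynomial (Fin 3) ℤ,
      ∀ (R : Type*) [CommRing R] (X Y : Matrix.SpecialLinearGroup (Fin 2) R),
        Matrix.trace ((FreeGroup.lift ![X, Y] w : Matrix.SpecialLinearGroup (Fin 2) R) :
            Matrix (Fin 2) (Fin 2) R)
          = MvPolynomial.aeval
              ![Matrix.trace (X : Matrix (Fin 2) (Fin 2) R),
                Matrix.trace (Y : Matrix (Fin 2) (Fin 2) R),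
                Matrix.trace ((X * Y : Matrix.SpecialLinearGroup (Fin 2) R) :
                  Matrix (Fin 2) (Fin 2) R)] P := by
  intro w
  obtain ⟨a, b, c, d, h⟩ := exists_word_eq_combination w
  refine ⟨a + a + MvPolynomial.X 0 * b + MvPolynomial.X 1 * c + MvPolynomial.X 2 * d,
    fun R _ X Y => ?_⟩
  change _ = traceEval X Y _
  rw [h]
  simp
  ring
end

section
/- Let n be an odd prime and q a power of an odd prime p with p ≠ n. Then the number of matrices A ∈ SL(2,F_q) satisfying Aⁿ = 1 equals: 1 + ((n−1)/2)·q(q+1) if n divides q−1; 1 + ((n−1)/2)·q(q−1) if n divides q+1; and 1 otherwise. (Equivalently, this is the number of group homomorphisms from ℤ/nℤ to SL(2,F_q).) -/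
open Polynomial in
theorem FiniteField.pow_card_eq_self_iff {F K : Type*} [Field F] [Fintype F] [Field K]
    [Algebra F K] {x : K} :
    x ^ Fintype.card F = x ↔ x ∈ Set.range (algebraMap F K) := by
  classical
  constructor
  · intro hx
    have hne : (X ^ Fintype.card F - X : F[X]).map (algebraMap F K) ≠ 0 :=
      Polynomial.map_ne_zero (FiniteField.X_pow_card_sub_X_ne_zero F Fintype.one_lt_card)
    have hmap := Polynomial.roots_map_of_injective_of_card_eq_natDegree
      (p := (X ^ Fintype.card F - X : F[X])) (algebraMap F K).injective (by
        rw [FiniteField.roots_X_pow_card_sub_X,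
          FiniteField.X_pow_card_sub_X_natDegree_eq F Fintype.one_lt_card]
        rfl)
    have hroot : x ∈ ((X ^ Fintype.card F - X : F[X]).map (algebraMap F K)).roots := by
      rw [Polynomial.mem_roots hne]
      simp [hx]
    rw [← hmap, FiniteField.roots_X_pow_card_sub_X, Multiset.mem_map] at hroot
    obtain ⟨a, -, ha⟩ := hroot
    exact ⟨a, ha⟩
  · rintro ⟨a, rfl⟩
    rw [← map_pow, FiniteField.pow_card]

theorem ne_inv_of_pow_eq_one {K : Type*} [Field K] {n : ℕ} (hodd : Odd n) {ζ : K}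
    (hζ : ζ ^ n = 1) (h1 : ζ ≠ 1) : ζ ≠ ζ⁻¹ := by
  intro h
  have hζ0 : ζ ≠ 0 := by
    rintro rfl
    simp [hodd.pos.ne'] at hζ
  have h2 : ζ ^ 2 = 1 := by rw [pow_two]; nth_rw 2 [h]; exact mul_inv_cancel₀ hζ0
  obtain ⟨m, rfl⟩ := hodd
  rw [pow_succ, pow_mul, h2, one_pow, one_mul] at hζ
  exact h1 hζ

namespace Matrix.SpecialLinearGroup

theorem fin_two_mul_self {R : Type*} [CommRing R] (A : SpecialLinearGroup (Fin 2) R) :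
    A.1 * A.1 = A.1.trace • A.1 - 1 := by
  have h := A.det_coe
  rw [Matrix.det_fin_two] at h
  ext i j
  fin_cases i <;> fin_cases j <;>
    simp [Matrix.mul_apply, Matrix.trace_fin_two] <;>
    first | linear_combination -h | ring1

open Polynomial in
theorem pow_eq_one_of_trace_eq {K : Type*} [Field K] {n : ℕ} {ζ : K} (hζ : ζ ^ n = 1)
    (hζ0 : ζ ≠ 0) (hne : ζ ≠ ζ⁻¹) {A : SpecialLinearGroup (Fin 2) K} (hA : A.1.trace = ζ + ζ⁻¹) :
    A ^ n = 1 := by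
  have hdvd : (X - C ζ) * (X - C ζ⁻¹) ∣ (X ^ n - 1 : K[X]) := by
    refine (Polynomial.isCoprime_X_sub_C_of_isUnit_sub ?_).mul_dvd ?_ ?_
    · exact (sub_ne_zero.2 hne).isUnit
    · rw [Polynomial.dvd_iff_isRoot]; simp [hζ]
    · rw [Polynomial.dvd_iff_isRoot]; simp [hζ]
  obtain ⟨g, hg⟩ := hdvd
  have h := congrArg (aeval A.1) hg
  have hz : aeval A.1 ((X - C ζ) * (X - C ζ⁻¹)) = 0 := by
    have hexp : (X - C ζ) * (X - C ζ⁻¹) = X * X - (ζ + ζ⁻¹) • X + 1 := by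
      have : C ζ * C ζ⁻¹ = (1 : K[X]) := by rw [← C_mul, mul_inv_cancel₀ hζ0, C_1]
      rw [smul_eq_C_mul, C_add]
      linear_combination this
    rw [hexp]
    simp [fin_two_mul_self, hA]
  rw [map_mul, hz, zero_mul] at h
  apply Subtype.ext
  simpa [sub_eq_zero] using h

theorem eq_one_of_trace_eq_two {K : Type*} [Field K] {n : ℕ} (hn : (n : K) ≠ 0)
    {A : SpecialLinearGroup (Fin 2) K} (hA : A ^ n = 1) (ht : A.1.trace = 2) : A = 1 := by
  have hsq := fin_two_mul_self A
  rw [ht] at hsq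
  have hpow (k : ℕ) : A.1 ^ k = 1 + (k : K) • (A.1 - 1) := by
    induction k with
    | zero => simp
    | succ k ih =>
      rw [pow_succ, ih, add_mul, smul_mul_assoc, sub_mul, hsq, one_mul]
      push_cast
      module
  have h1 : A.1 ^ n = 1 := by rw [← coe_pow, hA, coe_one]
  rw [hpow, add_eq_left, smul_eq_zero_iff_right hn, sub_eq_zero] at h1
  exact Subtype.ext h1

theorem exists_trace_eq_add_inv_of_pow_eq_one {K : Type*} [Field K] [IsAlgClosed K] {n : ℕ}
    {A : SpecialLinearGroup (Fin 2) K} (hA : A ^ n = 1) :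
    ∃ ζ : K, ζ ^ n = 1 ∧ A.1.trace = ζ + ζ⁻¹ := by
  obtain ⟨ζ, hζ⟩ := Module.End.exists_eigenvalue (Matrix.toLin' A.1)
  obtain ⟨v, hv⟩ := hζ.exists_hasEigenvector
  have hpow := hv.pow_apply n
  have h1 : A.1 ^ n = 1 := by rw [← coe_pow, hA, coe_one]
  rw [← Matrix.toLin'_pow, h1, Matrix.toLin'_one, LinearMap.id_apply] at hpow
  have hsq := hv.pow_apply 2
  rw [← Matrix.toLin'_pow, pow_two, fin_two_mul_self, map_sub, map_smul, LinearMap.sub_apply,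
    LinearMap.smul_apply, hv.apply_eq_smul, Matrix.toLin'_one, LinearMap.id_apply] at hsq
  have e1 : (ζ ^ n - 1) • v = 0 := by rw [sub_smul, one_smul, ← hpow, sub_self]
  have e2 : (A.1.trace * ζ - 1 - ζ ^ 2) • v = 0 := by
    rw [sub_smul, ← hsq]; module
  have f1 := (smul_eq_zero_iff_left hv.2).1 e1
  have f2 := (smul_eq_zero_iff_left hv.2).1 e2
  have hζ0 : ζ ≠ 0 := by
    rintro rfl
    simp at f2
  refine ⟨ζ, sub_eq_zero.1 f1, ?_⟩
  field_simp
  linear_combination f2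

theorem pow_eq_one_iff_trace {F K : Type*} [Field F] [Field K] [Algebra F K] [IsAlgClosed K]
    {n : ℕ} (hodd : Odd n) (hn : (n : F) ≠ 0) (A : SpecialLinearGroup (Fin 2) F) :
    A ^ n = 1 ↔ A = 1 ∨
      ∃ ζ : K, ζ ^ n = 1 ∧ ζ ≠ 1 ∧ algebraMap F K A.1.trace = ζ + ζ⁻¹ := by
  have htr : algebraMap F K A.1.trace = (map (algebraMap F K) A).1.trace := by
    simp [Matrix.trace_fin_two]
  constructor
  · intro hA
    have hA' : map (algebraMap F K) A ^ n = 1 := by rw [← map_pow, hA, map_one]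
    obtain ⟨ζ, hζ, ht⟩ := exists_trace_eq_add_inv_of_pow_eq_one hA'
    by_cases h1 : ζ = 1
    · left
      refine eq_one_of_trace_eq_two hn hA ((algebraMap F K).injective ?_)
      rw [htr, ht, h1, map_ofNat]
      norm_num
    · exact .inr ⟨ζ, hζ, h1, htr.trans ht⟩
  · rintro (rfl | ⟨ζ, hζ, h1, ht⟩)
    · exact one_pow n
    · have hζ0 : ζ ≠ 0 := by
        rintro rfl
        simp [hodd.pos.ne'] at hζ
      have := pow_eq_one_of_trace_eq hζ hζ0 (ne_inv_of_pow_eq_one hodd hζ h1) (htr ▸ ht)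
      rw [← map_pow, ← map_one (map (algebraMap F K))] at this
      apply Subtype.ext
      apply Matrix.map_injective (algebraMap F K).injective
      exact congrArg Subtype.val this

end Matrix.SpecialLinearGroup

theorem card_filter_mul_eq {F : Type*} [Field F] [Fintype F] [DecidableEq F] (x : F) :
    (Finset.univ.filter fun y : F × F => y.1 * y.2 = x).card =
      (Fintype.card F - 1) + if x = 0 then Fintype.card F else 0 := by
  have hfib (b : F) (hb : b ∈ Finset.univ.erase (0 : F)) :
      (∑ c : F, if b * c = x then 1 else 0) = 1 := by
    have hb0 := Finset.ne_of_mem_erase hb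
    rw [Finset.sum_eq_single (b⁻¹ * x)]
    · simp [hb0]
    · intro c _ hc
      rw [if_neg]
      rintro rfl
      simp [hb0] at hc
    · simp
  rw [Finset.card_filter, Fintype.sum_prod_type,
    ← Finset.sum_erase_add _ _ (Finset.mem_univ (0 : F)), Finset.sum_congr rfl hfib]
  congr 1
  · simp [Finset.card_erase_of_mem]
  · by_cases hx : x = 0
    · simp [hx]
    · simp [hx, Ne.symm hx]

namespace Matrix.SpecialLinearGroup

/-- Matrices of determinant one and trace `t`, parametrised by their upper left entry and
their two off-diagonal entries. -/
def traceEqEquiv {R : Type*} [CommRing R] (t : R) :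
    {A : SpecialLinearGroup (Fin 2) R // A.1.trace = t} ≃
      Σ a : R, {y : R × R // y.1 * y.2 = a * (t - a) - 1} where
  toFun A := ⟨A.1.1 0 0, (A.1.1 0 1, A.1.1 1 0), by
    have h := A.1.det_coe
    rw [Matrix.det_fin_two] at h
    have ht := A.2
    rw [Matrix.trace_fin_two] at ht
    linear_combination -h + A.1.1 0 0 * ht⟩
  invFun y := ⟨⟨!![y.1, y.2.1.1; y.2.1.2, t - y.1], by
    rw [Matrix.det_fin_two_of, y.2.2]; ring⟩, by simp [Matrix.trace_fin_two]⟩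
  left_inv A := by
    have ht := A.2
    rw [Matrix.trace_fin_two] at ht
    apply Subtype.ext
    apply Subtype.ext
    ext i j
    fin_cases i <;> fin_cases j <;> simp [← ht]
  right_inv y := by simp

theorem card_trace_eq {F : Type*} [Field F] [Fintype F] [DecidableEq F] (t : F) :
    Nat.card {A : SpecialLinearGroup (Fin 2) F // A.1.trace = t} =
      Fintype.card F * (Fintype.card F - 1) +
        Fintype.card F * (Finset.univ.filter fun a : F => a * (t - a) = 1).card := by
  rw [Nat.card_congr (traceEqEquiv t), Nat.card_eq_fintype_card, Fintype.card_sigma]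
  simp_rw [Fintype.card_subtype, card_filter_mul_eq, sub_eq_zero]
  rw [Finset.sum_add_distrib, ← Finset.sum_filter]
  simp [mul_comm]

theorem card_trace_eq_add_inv {F K : Type*} [Field F] [Fintype F] [Field K] [Algebra F K]
    [DecidableEq K] {ζ : K} (hζ0 : ζ ≠ 0) (hne : ζ ≠ ζ⁻¹) {t : F} (ht : algebraMap F K t = ζ + ζ⁻¹) :
    Nat.card {A : SpecialLinearGroup (Fin 2) F // A.1.trace = t} =
      if ζ ^ Fintype.card F = ζ then Fintype.card F * (Fintype.card F + 1)
      else Fintype.card F * (Fintype.card F - 1) := by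
  classical
  have hroot (a : F) : a * (t - a) = 1 ↔ algebraMap F K a = ζ ∨ algebraMap F K a = ζ⁻¹ := by
    rw [← (algebraMap F K).injective.eq_iff, ← sub_eq_zero (b := ζ), ← sub_eq_zero (b := ζ⁻¹),
      ← mul_eq_zero, map_mul, map_sub, map_one, ht, ← sub_eq_zero]
    have h := mul_inv_cancel₀ hζ0
    constructor <;> intro hroots <;> linear_combination -hroots + h
  rw [card_trace_eq]
  simp_rw [hroot]
  split_ifs with h
  · obtain ⟨a, rfl⟩ := FiniteField.pow_card_eq_self_iff.1 h
    rw [← map_inv₀] at hne ⊢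
    have : (Finset.univ.filter fun b : F =>
        algebraMap F K b = algebraMap F K a ∨ algebraMap F K b = algebraMap F K a⁻¹) =
        {a, a⁻¹} := by
      ext b
      simp only [(algebraMap F K).injective.eq_iff, Finset.mem_filter, Finset.mem_univ,
        true_and, Finset.mem_insert, Finset.mem_singleton]
    rw [this, Finset.card_pair fun h => hne (congrArg _ h), ← mul_add]
    have := Fintype.card_pos (α := F)
    congr 1
    omega
  · rw [FiniteField.pow_card_eq_self_iff] at h
    rw [Finset.filter_false_of_mem, Finset.card_empty, mul_zero, add_zero]
    rintro a - (ha | ha)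
    · exact h ⟨a, ha⟩
    · exact h ⟨a⁻¹, by rw [map_inv₀, ha, inv_inv]⟩

end Matrix.SpecialLinearGroup

theorem add_inv_eq_add_inv_iff {K : Type*} [Field K] {x y : K} (hx : x ≠ 0) (hy : y ≠ 0) :
    x + x⁻¹ = y + y⁻¹ ↔ x = y ∨ x = y⁻¹ := by
  constructor
  · intro h
    have : (x - y) * (x - y⁻¹) = 0 := by
      linear_combination x * h - mul_inv_cancel₀ hx + mul_inv_cancel₀ hy
    simpa [sub_eq_zero] using this
  · rintro (rfl | rfl)
    · rfl
    · rw [inv_inv, add_comm]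

theorem card_image_add_inv_nthRoots {K : Type*} [Field K] [DecidableEq K] {n : ℕ}
    (hodd : Odd n) {ζ : K} (hζ : IsPrimitiveRoot ζ n) :
    (((Polynomial.nthRootsFinset n (1 : K)).erase 1).image fun x => x + x⁻¹).card =
      (n - 1) / 2 := by
  have hmem (x : K) : x ∈ (Polynomial.nthRootsFinset n (1 : K)).erase 1 ↔ x ≠ 1 ∧ x ^ n = 1 := by
    rw [Finset.mem_erase, Polynomial.mem_nthRootsFinset hodd.pos]
  have h0 {x : K} (hx : x ^ n = 1) : x ≠ 0 := by
    rintro rfl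
    simp [hodd.pos.ne'] at hx
  have hcard : ((Polynomial.nthRootsFinset n (1 : K)).erase 1).card = n - 1 := by
    rw [Finset.card_erase_of_mem ((Polynomial.mem_nthRootsFinset hodd.pos _).2 (one_pow n)),
      hζ.card_nthRootsFinset]
  rw [← hcard, Finset.card_eq_sum_card_image (fun x : K => x + x⁻¹)
      ((Polynomial.nthRootsFinset n (1 : K)).erase 1),
    Finset.sum_const_nat (m := 2), Nat.mul_div_cancel _ two_pos]
  intro t ht
  obtain ⟨x, hx, rfl⟩ := Finset.mem_image.1 ht
  obtain ⟨hx1, hxn⟩ := (hmem x).1 hx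
  rw [← Finset.card_pair (ne_inv_of_pow_eq_one hodd hxn hx1)]
  congr 1
  ext y
  rw [Finset.mem_filter, hmem, Finset.mem_insert, Finset.mem_singleton]
  constructor
  · rintro ⟨⟨hy1, hyn⟩, h⟩
    exact (add_inv_eq_add_inv_iff (h0 hyn) (h0 hxn)).1 h
  · rintro (rfl | rfl)
    · exact ⟨⟨hx1, hxn⟩, rfl⟩
    · exact ⟨⟨inv_ne_one.2 hx1, by rw [inv_pow, hxn, inv_one]⟩, by rw [inv_inv, add_comm]⟩



/-- **Counting `n`-torsion in `SL(2,F_q)`.**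
Let `n` be an odd prime and `q = p^r` a power of an odd prime `p ≠ n`.  The number of
matrices `A ∈ SL(2,F_q)` with `Aⁿ = 1` (equivalently, the number of group homomorphisms
`ℤ/nℤ → SL(2,F_q)`) is `1 + ((n−1)/2)·q(q+1)` if `n ∣ q−1`, `1 + ((n−1)/2)·q(q−1)` if
`n ∣ q+1`, and `1` otherwise. -/
theorem card_n_torsion_SL2_Fq (p r n : ℕ) (hp : p.Prime) (hpodd : Odd p)
    (hn : n.Prime) (hnodd : Odd n) (hpn : p ≠ n) (hr : 0 < r)
    (F : Type*) [Field F] [Fintype F] (hF : Fintype.card F = p ^ r) :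
    Nat.card {A : Matrix.SpecialLinearGroup (Fin 2) F // A ^ n = 1} =
      if n ∣ p ^ r - 1 then 1 + (n - 1) / 2 * (p ^ r * (p ^ r + 1))
      else if n ∣ p ^ r + 1 then 1 + (n - 1) / 2 * (p ^ r * (p ^ r - 1))
      else 1 := by
  classical
  rw [← hF]
  have hq : 0 < Fintype.card F := Fintype.card_pos
  have hcop : Nat.Coprime n (Fintype.card F) := by
    rw [hF]
    exact ((Nat.coprime_primes hn hp).2 hpn.symm).pow_right r
  have hnF : (n : F) ≠ 0 := by
    intro h
    have h1 := Nat.isCoprime_iff_coprime.2 hcop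
    obtain ⟨a, b, hab⟩ := h1
    have := congrArg (Int.cast : ℤ → F) hab
    simp [h] at this
  let K := AlgebraicClosure F
  have : NeZero (n : F) := ⟨hnF⟩
  obtain ⟨ζ, hζ⟩ := HasEnoughRootsOfUnity.exists_primitiveRoot K n
  have h0 {x : K} (hx : x ^ n = 1) : x ≠ 0 := by
    rintro rfl
    simp [hn.ne_zero] at hx
  set S := (Polynomial.nthRootsFinset n (1 : K)).erase 1
  have hmem (x : K) : x ∈ S ↔ x ≠ 1 ∧ x ^ n = 1 := by
    rw [Finset.mem_erase, Polynomial.mem_nthRootsFinset hn.pos]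
  have hord {x : K} (hx : x ∈ S) : orderOf x = n := by
    have := Fact.mk hn
    exact orderOf_eq_prime ((hmem x).1 hx).2 ((hmem x).1 hx).1
  have hfix {x : K} (hx : x ∈ S) : x ^ Fintype.card F = x ↔ n ∣ Fintype.card F - 1 := by
    rw [← hord hx, orderOf_dvd_iff_pow_eq_one]
    nth_rw 1 [← Nat.sub_add_cancel hq]
    rw [pow_succ, mul_eq_right₀ (h0 ((hmem x).1 hx).2)]
  have hinv {x : K} (hx : x ∈ S) : x ^ Fintype.card F = x⁻¹ ↔ n ∣ Fintype.card F + 1 := by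
    rw [← hord hx, orderOf_dvd_iff_pow_eq_one, pow_succ,
      mul_eq_one_iff_eq_inv₀ (h0 ((hmem x).1 hx).2)]
  have hrange {x : K} (hx : x ∈ S) : x + x⁻¹ ∈ Set.range (algebraMap F K) ↔
      n ∣ Fintype.card F - 1 ∨ n ∣ Fintype.card F + 1 := by
    have hx0 := h0 ((hmem x).1 hx).2
    have hfrob : (x + x⁻¹) ^ Fintype.card F = x ^ Fintype.card F + (x ^ Fintype.card F)⁻¹ := by
      simpa using map_add (FiniteField.frobeniusAlgHom F K) x x⁻¹
    rw [← FiniteField.pow_card_eq_self_iff, hfrob,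
      add_inv_eq_add_inv_iff (pow_ne_zero _ hx0) hx0, hfix hx, hinv hx]
  let T : Finset F := Finset.univ.filter fun t => algebraMap F K t ∈ S.image fun x => x + x⁻¹
  have hT (t : F) : t ∈ T ↔ ∃ x ∈ S, algebraMap F K t = x + x⁻¹ := by
    simp only [T, Finset.mem_filter, Finset.mem_univ, true_and, Finset.mem_image, eq_comm]
  have hcount : Nat.card {A : Matrix.SpecialLinearGroup (Fin 2) F // A ^ n = 1} =
      1 + ∑ t ∈ T, Nat.card {A : Matrix.SpecialLinearGroup (Fin 2) F // A.1.trace = t} := by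
    have hset : (Finset.univ.filter fun A : Matrix.SpecialLinearGroup (Fin 2) F => A ^ n = 1) =
        insert 1 (Finset.univ.filter fun A => A.1.trace ∈ T) := by
      ext A
      simp only [Finset.mem_filter, Finset.mem_univ, true_and, Finset.mem_insert, hT, hmem,
        Matrix.SpecialLinearGroup.pow_eq_one_iff_trace (K := K) hnodd hnF]
      simp only [and_assoc, and_left_comm]
    have hone : (1 : Matrix.SpecialLinearGroup (Fin 2) F) ∉
        Finset.univ.filter fun A => A.1.trace ∈ T := by
      simp only [Finset.mem_filter, Finset.mem_univ, true_and, hT, not_exists, not_and]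
      intro x hx h
      have htwo : x + x⁻¹ = 1 + 1⁻¹ := by
        rw [← h, Matrix.SpecialLinearGroup.coe_one, Matrix.trace_one, Fintype.card_fin, map_natCast,
          inv_one]
        norm_num
      rw [add_inv_eq_add_inv_iff (h0 ((hmem x).1 hx).2) one_ne_zero, inv_one, or_self] at htwo
      exact ((hmem x).1 hx).1 htwo
    rw [Nat.card_eq_fintype_card, Fintype.card_subtype, hset, Finset.card_insert_of_notMem hone,
      add_comm]
    congr 1
    refine (Finset.card_eq_sum_card_fiberwise (t := T)
      (f := fun A : Matrix.SpecialLinearGroup (Fin 2) F => A.1.trace)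
      (fun A hA => (Finset.mem_filter.1 hA).2)).trans ?_
    refine Finset.sum_congr rfl fun t ht => ?_
    rw [Nat.card_eq_fintype_card, Fintype.card_subtype, Finset.filter_filter]
    congr 1
    ext A
    simp only [Finset.mem_filter, Finset.mem_univ, true_and]
    exact ⟨fun h => h.2, fun h => ⟨h ▸ ht, h⟩⟩
  have hTcard (h : n ∣ Fintype.card F - 1 ∨ n ∣ Fintype.card F + 1) : T.card = (n - 1) / 2 := by
    rw [← card_image_add_inv_nthRoots hnodd hζ, ← Finset.card_image_of_injective T
      (algebraMap F K).injective]
    congr 1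
    ext y
    rw [Finset.mem_image, Finset.mem_image]
    constructor
    · rintro ⟨t, ht, rfl⟩
      obtain ⟨x, hx, h⟩ := (hT t).1 ht
      exact ⟨x, hx, h.symm⟩
    · rintro ⟨x, hx, rfl⟩
      obtain ⟨t, ht⟩ := (hrange hx).2 h
      exact ⟨t, (hT t).2 ⟨x, hx, ht⟩, ht⟩
  have hfiber {t : F} (ht : t ∈ T) :
      Nat.card {A : Matrix.SpecialLinearGroup (Fin 2) F // A.1.trace = t} =
        if n ∣ Fintype.card F - 1 then Fintype.card F * (Fintype.card F + 1)
        else Fintype.card F * (Fintype.card F - 1) := by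
    obtain ⟨x, hx, h⟩ := (hT t).1 ht
    obtain ⟨hx1, hxn⟩ := (hmem x).1 hx
    rw [Matrix.SpecialLinearGroup.card_trace_eq_add_inv (h0 hxn)
      (ne_inv_of_pow_eq_one hnodd hxn hx1) h]
    simp only [hfix hx]
  rw [hcount, Finset.sum_congr rfl fun t ht => hfiber ht, Finset.sum_const, smul_eq_mul]
  split_ifs with h1 h2
  · rw [hTcard (.inl h1)]
  · rw [hTcard (.inr h2)]
  · have : T = ∅ := by
      refine Finset.eq_empty_of_forall_notMem fun t ht => ?_
      obtain ⟨x, hx, h⟩ := (hT t).1 ht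
      exact ((hrange hx).1 ⟨t, h⟩).elim h1 h2
    rw [this, Finset.card_empty, zero_mul, add_zero]
end

section
/- Let q be a power of an odd prime p with p ∉ {3, 5}. Let a₁, a₂, a₃ ∈ SL(2,F_q) be elements with a₁² = −1, a₂³ = −1, a₃⁵ = −1, and aᵢ ∉ {1, −1} for each i. Then the number of triples (g₁, g₂, g₃) such that each gᵢ is conjugate to aᵢ in SL(2,F_q) and g₁g₂g₃ = −1 equals q(q²−1), the order of SL(2,F_q). -/
open Matrix

namespace SL2Count

variable {F : Type*} [Field F]

/-- Two nonzero diagonal coefficients represent every element of a finite field of odd order. -/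
theorem exists_diagonal_eq [Fintype F] (h2 : (2 : F) ≠ 0) {a b : F} (ha : a ≠ 0) (hb : b ≠ 0)
    (c : F) : ∃ x y : F, a * x ^ 2 + b * y ^ 2 = c := by
  open Polynomial in
  obtain ⟨x, y, h⟩ := FiniteField.exists_root_sum_quadratic
    (f := C a * X ^ 2 + C 0 * X + C (-c)) (g := C b * X ^ 2 + C 0 * X + C 0)
    (degree_quadratic ha) (degree_quadratic hb)
    (FiniteField.odd_card_of_char_ne_two fun h => h2 (by
      have := ringChar.Nat.cast_ringChar (R := F)
      rw [h] at this
      exact_mod_cast this))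
  refine ⟨x, y, ?_⟩
  simp at h
  linear_combination h

/-- A nondegenerate binary quadratic form over a finite field of odd order represents `1`. -/
theorem exists_quadratic_form_eq_one [Fintype F] (h2 : (2 : F) ≠ 0) {a b c : F}
    (h : b ^ 2 - 4 * a * c ≠ 0) : ∃ x y : F, a * x ^ 2 + b * x * y + c * y ^ 2 = 1 := by
  have key : ∀ {a b c : F}, a ≠ 0 → b ^ 2 - 4 * a * c ≠ 0 →
      ∃ x y : F, a * x ^ 2 + b * x * y + c * y ^ 2 = 1 := by
    intro a b c ha h
    have hb : -(b ^ 2 - 4 * a * c) / (4 * a) ≠ 0 := by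
      have : (4 : F) = 2 * 2 := by norm_num
      rw [this] at h ⊢
      exact div_ne_zero (neg_ne_zero.mpr h) (mul_ne_zero (mul_ne_zero h2 h2) ha)
    obtain ⟨x, y, hxy⟩ := exists_diagonal_eq h2 ha hb 1
    refine ⟨x - b * y / (2 * a), y, ?_⟩
    rw [← hxy]
    have : (4 : F) = 2 * 2 := by norm_num
    rw [this]
    field_simp
    ring
  by_cases ha : a = 0
  · by_cases hc : c = 0
    · subst ha hc
      have hb : b ≠ 0 := by rintro rfl; simp at h
      exact ⟨1, b⁻¹, by field_simp; ring⟩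
    · obtain ⟨x, y, hxy⟩ := key (a := c) (b := b) (c := a) hc (by convert h using 1; ring)
      exact ⟨y, x, by linear_combination hxy⟩
  · exact key ha h

theorem det_eq_one (A : Matrix.SpecialLinearGroup (Fin 2) F) : A 0 0 * A 1 1 - A 0 1 * A 1 0 = 1 := by
  rw [← det_fin_two]; exact A.2

theorem conj_eq_iff {g A B : Matrix.SpecialLinearGroup (Fin 2) F} :
    g * A * g⁻¹ = B ↔ (g : Matrix (Fin 2) (Fin 2) F) * A = B * g :=
  (mul_inv_eq_iff_eq_mul (G := Matrix.SpecialLinearGroup (Fin 2) F)).trans Subtype.ext_iff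

/-- The companion matrix of `X ^ 2 - s * X + 1`. -/
def companion (s : F) : Matrix.SpecialLinearGroup (Fin 2) F :=
  ⟨!![0, -1; 1, s], by simp [det_fin_two]⟩

theorem coe_companion (s : F) : (companion s : Matrix (Fin 2) (Fin 2) F) = !![0, -1; 1, s] := rfl

theorem isConj_companion [Fintype F] (h2 : (2 : F) ≠ 0) (A : Matrix.SpecialLinearGroup (Fin 2) F)
    {s : F} (hA : A 0 0 + A 1 1 = s) (hs : s ^ 2 ≠ 4) : IsConj (companion s) A := by
  have hdet := det_eq_one A
  obtain ⟨x, y, hxy⟩ := exists_quadratic_form_eq_one h2 (a := A 1 0) (b := A 1 1 - A 0 0)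
    (c := -A 0 1) (fun h => hs (by rw [← hA]; linear_combination h + 4 * hdet))
  refine isConj_iff.mpr ⟨⟨!![x, A 0 0 * x + A 0 1 * y; y, A 1 0 * x + A 1 1 * y], ?_⟩,
    conj_eq_iff.mpr ?_⟩
  · simp [det_fin_two]
    linear_combination hxy
  · ext i j
    fin_cases i <;> fin_cases j <;>
      simp [coe_companion, mul_apply, Fin.sum_univ_two] <;>
      rw [← hA]
    · linear_combination x * hdet
    · linear_combination y * hdet

theorem trace_eq_of_isConj {A B : Matrix.SpecialLinearGroup (Fin 2) F} (h : IsConj A B) :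
    A 0 0 + A 1 1 = B 0 0 + B 1 1 := by
  obtain ⟨c, rfl⟩ := isConj_iff.mp h
  have := trace_mul_comm (c.1 * A.1) (c⁻¹).1
  rw [← mul_assoc, ← Matrix.SpecialLinearGroup.coe_mul, ← Matrix.SpecialLinearGroup.coe_mul,
    ← Matrix.SpecialLinearGroup.coe_mul, ← Matrix.SpecialLinearGroup.coe_mul, inv_mul_cancel, one_mul] at this
  simpa [trace_fin_two] using this.symm

/-- Away from traces `±2`, conjugacy in `SL(2,F)` over a finite field is detected by the trace. -/
theorem isConj_iff_trace_eq [Fintype F] (h2 : (2 : F) ≠ 0) {A B : Matrix.SpecialLinearGroup (Fin 2) F}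
    {s : F} (hA : A 0 0 + A 1 1 = s) (hs : s ^ 2 ≠ 4) : IsConj A B ↔ B 0 0 + B 1 1 = s :=
  ⟨fun h => (trace_eq_of_isConj h).symm.trans hA,
    fun hB => (isConj_companion h2 A hA hs).symm.trans (isConj_companion h2 B hB hs)⟩

/-- A parametrisation of `SL(2,F)`: the first column is any nonzero vector, and the second
column then ranges over a line. -/
noncomputable def equivNonzeroProd :
    Matrix.SpecialLinearGroup (Fin 2) F ≃ {v : F × F // v ≠ 0} × F := by
  classical exact
  { toFun := fun A => (⟨(A 0 0, A 1 0), fun h => by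
        have hdet := det_eq_one A
        simp only [Prod.mk_eq_zero] at h
        simp [h.1, h.2] at hdet⟩, if A 0 0 = 0 then A 1 1 else A 0 1)
    invFun := fun v =>
      ⟨if v.1.1.1 = 0 then !![0, -v.1.1.2⁻¹; v.1.1.2, v.2]
        else !![v.1.1.1, v.2; v.1.1.2, (1 + v.2 * v.1.1.2) / v.1.1.1], by
        obtain ⟨⟨⟨a, c⟩, h⟩, k⟩ := v
        by_cases ha : a = 0
        · have hc : c ≠ 0 := by rintro rfl; exact h (by simp [ha])
          simp [ha, hc]
        · simp [ha, det_fin_two]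
          field_simp
          ring⟩
    left_inv := fun A => by
      have hdet := det_eq_one A
      by_cases ha : A 0 0 = 0
      · rw [ha] at hdet
        have hc : A 1 0 ≠ 0 := fun hc => by simp [hc] at hdet
        ext i j
        fin_cases i <;> fin_cases j <;> simp [ha]
        field_simp
        linear_combination hdet
      · ext i j
        fin_cases i <;> fin_cases j <;> simp [ha]
        field_simp
        linear_combination -hdet
    right_inv := fun v => by
      obtain ⟨⟨⟨a, c⟩, h⟩, k⟩ := v
      by_cases ha : a = 0 <;> simp [ha] }

theorem card_SL2 [Fintype F] : Nat.card (Matrix.SpecialLinearGroup (Fin 2) F) =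
    Fintype.card F * (Fintype.card F ^ 2 - 1) := by
  classical
  rw [Nat.card_congr equivNonzeroProd, Nat.card_prod, Nat.card_eq_fintype_card,
    Nat.card_eq_fintype_card, Fintype.card_subtype_compl, Fintype.card_prod,
    Fintype.card_subtype_eq, mul_comm, sq]

theorem eq_or_eq_neg_of_smul_eq {A : Matrix.SpecialLinearGroup (Fin 2) F} {c k : F} (hc : c ≠ 0)
    (h : c • (A : Matrix (Fin 2) (Fin 2) F) = k • 1) :
    A = 1 ∨ (A : Matrix (Fin 2) (Fin 2) F) = -1 := by
  have hdet := det_eq_one A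
  have h00 := congrFun₂ h 0 0
  have h01 := congrFun₂ h 0 1
  have h10 := congrFun₂ h 1 0
  have h11 := congrFun₂ h 1 1
  simp [hc] at h00 h01 h10 h11
  have he : A 1 1 = A 0 0 := mul_left_cancel₀ hc (h11.trans h00.symm)
  rw [he, h01] at hdet
  have : (A 0 0 - 1) * (A 0 0 + 1) = 0 := by linear_combination hdet
  rcases mul_eq_zero.mp this with h | h
  · left
    ext i j
    fin_cases i <;> fin_cases j <;> simp [h01, h10, he, sub_eq_zero.mp h]
  · right
    ext i j
    fin_cases i <;> fin_cases j <;> simp [h01, h10, he, eq_neg_of_add_eq_zero_left h]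

theorem sq_eq (A : Matrix.SpecialLinearGroup (Fin 2) F) :
    (A : Matrix (Fin 2) (Fin 2) F) * A = (A 0 0 + A 1 1) • (A : Matrix (Fin 2) (Fin 2) F) - 1 := by
  have hdet := det_eq_one A
  ext i j
  fin_cases i <;> fin_cases j <;> simp [mul_apply, Fin.sum_univ_two]
  · linear_combination -hdet
  · ring
  · ring
  · linear_combination -hdet

theorem trace_of_sq {A : Matrix.SpecialLinearGroup (Fin 2) F}
    (h : ((A ^ 2 : Matrix.SpecialLinearGroup (Fin 2) F) : Matrix (Fin 2) (Fin 2) F) = -1)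
    (h1 : A ≠ 1) (hn : (A : Matrix (Fin 2) (Fin 2) F) ≠ -1) : A 0 0 + A 1 1 = 0 := by
  by_contra hs
  rw [Matrix.SpecialLinearGroup.coe_pow, sq, sq_eq] at h
  have := eq_or_eq_neg_of_smul_eq (A := A) (k := 0) hs (by rw [zero_smul]; simpa using h)
  tauto

theorem trace_of_cube {A : Matrix.SpecialLinearGroup (Fin 2) F}
    (h : ((A ^ 3 : Matrix.SpecialLinearGroup (Fin 2) F) : Matrix (Fin 2) (Fin 2) F) = -1)
    (h1 : A ≠ 1) (hn : (A : Matrix (Fin 2) (Fin 2) F) ≠ -1) : A 0 0 + A 1 1 = 1 := by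
  have hsq := sq_eq A
  set s := A 0 0 + A 1 1
  have h3 : (s ^ 2 - 1) • (A : Matrix (Fin 2) (Fin 2) F) = (s - 1) • 1 := by
    rw [Matrix.SpecialLinearGroup.coe_pow, pow_succ, sq, hsq, sub_mul, smul_mul_assoc, hsq] at h
    simp only [one_mul, smul_sub, smul_smul] at h
    linear_combination (norm := module) h
  by_cases hs : s ^ 2 - 1 = 0
  · rw [hs, zero_smul] at h3
    have := congrFun₂ h3 0 0
    simp at this
    linear_combination -this
  · have := eq_or_eq_neg_of_smul_eq hs h3
    tauto

theorem trace_of_fifth {A : Matrix.SpecialLinearGroup (Fin 2) F} (h2 : (2 : F) ≠ 0)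
    (h : ((A ^ 5 : Matrix.SpecialLinearGroup (Fin 2) F) : Matrix (Fin 2) (Fin 2) F) = -1)
    (h1 : A ≠ 1) (hn : (A : Matrix (Fin 2) (Fin 2) F) ≠ -1) :
    (A 0 0 + A 1 1) ^ 2 = A 0 0 + A 1 1 + 1 := by
  have hsq := sq_eq A
  set s := A 0 0 + A 1 1
  have h5 : (s ^ 4 - 3 * s ^ 2 + 1) • (A : Matrix (Fin 2) (Fin 2) F)
      = (s ^ 3 - 2 * s - 1) • 1 := by
    have h4 : (A : Matrix (Fin 2) (Fin 2) F) ^ 4 =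
        (s ^ 3 - 2 * s) • (A : Matrix (Fin 2) (Fin 2) F) - (s ^ 2 - 1) • 1 := by
      rw [pow_mul _ 2 2, sq (A : Matrix (Fin 2) (Fin 2) F), hsq, sq, sub_mul, mul_sub, smul_mul_smul_comm, hsq]
      simp only [one_mul, mul_one, smul_sub, smul_smul]
      module
    rw [Matrix.SpecialLinearGroup.coe_pow, pow_succ, h4, sub_mul, smul_mul_assoc, hsq] at h
    simp only [one_mul, smul_sub, smul_smul, smul_mul_assoc] at h
    linear_combination (norm := module) h
  by_cases hs : s ^ 4 - 3 * s ^ 2 + 1 = 0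
  · rw [hs, zero_smul] at h5
    have h6 := congrFun₂ h5 0 0
    simp at h6
    have : (s ^ 2 - s - 1) * (s ^ 2 + s - 1) = 0 := by linear_combination hs
    rcases mul_eq_zero.mp this with h | h
    · linear_combination h
    · exact absurd (show (2 : F) = 0 by linear_combination h6 + (s - 1) * h) h2
  · have := eq_or_eq_neg_of_smul_eq hs h5
    tauto

/-- Points of the conic `x ^ 2 + y ^ 2 = c`. -/
abbrev Conic (c : F) : Type _ := {v : F × F // v.1 ^ 2 + v.2 ^ 2 = c}

/-- The norm torsor `x ^ 2 + y ^ 2 = m ^ 2 + n ^ 2` is a translate of the norm-one torus. -/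
def conicEquiv {c m n : F} (hc : c ≠ 0) (h : m ^ 2 + n ^ 2 = c) : Conic (1 : F) ≃ Conic c where
  toFun v := ⟨(m * v.1.1 - n * v.1.2, m * v.1.2 + n * v.1.1), by
    have := v.2
    linear_combination c * this + (v.1.1 ^ 2 + v.1.2 ^ 2) * h⟩
  invFun v := ⟨((m * v.1.1 + n * v.1.2) / c, (m * v.1.2 - n * v.1.1) / c), by
    have := v.2
    field_simp
    linear_combination (m ^ 2 + n ^ 2) * this + c * h⟩
  left_inv v := by
    ext
    · simp only []
      field_simp
      linear_combination v.1.1 * h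
    · simp only []
      field_simp
      linear_combination v.1.2 * h
  right_inv v := by
    ext
    · simp only []
      field_simp
      linear_combination v.1.1 * h
    · simp only []
      field_simp
      linear_combination v.1.2 * h

/-- The centralizer of the quarter turn is the norm-one torus. -/
def stabilizerEquiv : {g : Matrix.SpecialLinearGroup (Fin 2) F // g * companion 0 * g⁻¹ = companion 0} ≃
    Conic (1 : F) where
  toFun g := ⟨(g.1 0 0, g.1 1 0), by
    have hdet := det_eq_one g.1
    have h := conj_eq_iff.mp g.2
    have h00 := congrFun₂ h 0 0
    have h10 := congrFun₂ h 1 0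
    simp [coe_companion, mul_apply, Fin.sum_univ_two] at h00 h10
    rw [h00, h10] at hdet
    linear_combination hdet⟩
  invFun v := ⟨⟨!![v.1.1, -v.1.2; v.1.2, v.1.1], by
      rw [det_fin_two_of]
      linear_combination v.2⟩, conj_eq_iff.mpr <| by
    ext i j
    fin_cases i <;> fin_cases j <;>
      simp [coe_companion, mul_apply, Fin.sum_univ_two]⟩
  left_inv g := by
    have h := conj_eq_iff.mp g.2
    have h00 := congrFun₂ h 0 0
    have h10 := congrFun₂ h 1 0
    simp [coe_companion, mul_apply, Fin.sum_univ_two] at h00 h10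
    ext i j
    fin_cases i <;> fin_cases j <;> simp [h00, h10]
  right_inv v := by simp

theorem trace_companion_mul (B : Matrix.SpecialLinearGroup (Fin 2) F) :
    (companion 0 * B : Matrix.SpecialLinearGroup (Fin 2) F) 0 0 +
      (companion 0 * B : Matrix.SpecialLinearGroup (Fin 2) F) 1 1 = B 0 1 - B 1 0 := by
  simp [Matrix.SpecialLinearGroup.coe_mul, coe_companion, mul_apply, Fin.sum_univ_two]
  ring

/-- Elements of trace `1` whose product with the quarter turn has trace `-t` form a conic. -/
def sliceEquiv (h2 : (2 : F) ≠ 0) (t : F) : {B : Matrix.SpecialLinearGroup (Fin 2) F //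
      B 0 0 + B 1 1 = 1 ∧
        (companion 0 * B : Matrix.SpecialLinearGroup (Fin 2) F) 0 0 +
          (companion 0 * B : Matrix.SpecialLinearGroup (Fin 2) F) 1 1 = -t} ≃
    Conic (t ^ 2 - 3) where
  toFun B := ⟨(2 * B.1 0 0 - 1, 2 * B.1 1 0 - t), by
    have hdet := det_eq_one B.1
    obtain ⟨h1, ht⟩ := B.2
    rw [trace_companion_mul] at ht
    have h11 : B.1 1 1 = 1 - B.1 0 0 := by linear_combination h1
    have h01 : B.1 0 1 = B.1 1 0 - t := by linear_combination ht
    rw [h11, h01] at hdet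
    linear_combination -4 * hdet⟩
  invFun v := ⟨⟨!![(v.1.1 + 1) / 2, (v.1.2 + t) / 2 - t; (v.1.2 + t) / 2, 1 - (v.1.1 + 1) / 2], by
      rw [det_fin_two_of]
      field_simp
      linear_combination -v.2⟩, by
    simp, (trace_companion_mul _).trans (by simp)⟩
  left_inv B := by
    obtain ⟨h1, ht⟩ := B.2
    rw [trace_companion_mul] at ht
    have h11 : B.1 1 1 = 1 - B.1 0 0 := by linear_combination h1
    have h01 : B.1 0 1 = B.1 1 0 - t := by linear_combination ht
    ext i j
    fin_cases i <;> fin_cases j <;> simp [h11, h01] <;> field_simp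
  right_inv v := by
    ext <;> simp <;> field_simp <;> ring

/-- If every point of the class `X` of `x` carries a copy of the fibre `P x`, and the fibre has as
many points as the centralizer of `x`, then the total space is in bijection with the group. -/
theorem card_pairs_eq_card_group {G : Type*} [Group G] (x : G) (P : G → G → Prop)
    (hP : ∀ g y z, P y z ↔ P (g * y * g⁻¹) (g * z * g⁻¹))
    (e : {g : G // g * x * g⁻¹ = x} ≃ {z : G // P x z}) :
    Nat.card {w : G × G // IsConj x w.1 ∧ P w.1 w.2} = Nat.card G := by
  choose! s hs using fun y (h : IsConj x y) => isConj_iff.mp h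
  have hx : ∀ y, IsConj x y → x = (s y)⁻¹ * y * (s y)⁻¹⁻¹ := fun y h => by
    have := hs y h
    rw [mul_inv_eq_iff_eq_mul] at this
    rw [inv_inv, mul_assoc, ← this, inv_mul_cancel_left]
  let f₁ : {w : G × G // IsConj x w.1 ∧ P w.1 w.2} ≃ {y : G // IsConj x y} × {z : G // P x z} :=
    { toFun := fun w => (⟨w.1.1, w.2.1⟩, ⟨(s w.1.1)⁻¹ * w.1.2 * (s w.1.1)⁻¹⁻¹, by
        have := (hP (s w.1.1)⁻¹ _ _).mp w.2.2
        rwa [← hx _ w.2.1] at this⟩)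
      invFun := fun v => ⟨(v.1.1, s v.1.1 * v.2.1 * (s v.1.1)⁻¹), v.1.2, by
        have := (hP (s v.1.1) _ _).mp v.2.2
        rwa [hs _ v.1.2] at this⟩
      left_inv := fun w => by ext <;> simp [mul_assoc]
      right_inv := fun v => by ext <;> simp [mul_assoc] }
  let f₂ : G ≃ {y : G // IsConj x y} × {g : G // g * x * g⁻¹ = x} :=
    { toFun := fun g => (⟨g * x * g⁻¹, isConj_iff.mpr ⟨g, rfl⟩⟩, ⟨(s (g * x * g⁻¹))⁻¹ * g, by
        have := hx _ (isConj_iff.mpr ⟨g, rfl⟩)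
        conv_rhs => rw [this]
        simp [mul_assoc]⟩)
      invFun := fun v => s v.1.1 * v.2.1
      left_inv := fun g => by simp
      right_inv := fun v => by
        have : s v.1.1 * v.2.1 * x * (s v.1.1 * v.2.1)⁻¹ = v.1.1 := by
          calc s v.1.1 * v.2.1 * x * (s v.1.1 * v.2.1)⁻¹
              = s v.1.1 * (v.2.1 * x * v.2.1⁻¹) * (s v.1.1)⁻¹ := by group
            _ = v.1.1 := by rw [v.2.2, hs _ v.1.2]
        ext
        · exact this
        · dsimp only
          rw [this, inv_mul_cancel_left] }
  exact Nat.card_congr ((f₁.trans (Equiv.prodCongr (Equiv.refl _) e.symm)).trans f₂.symm)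

theorem natCast_ne_zero_of_card {p r n : ℕ} [Fintype F] (hp : p.Prime)
    (hF : Fintype.card F = p ^ r) (hn : n.Prime) (hpn : p ≠ n) : (n : F) ≠ 0 := by
  intro h
  have h0 : ((p ^ r : ℕ) : F) = 0 := by rw [← hF]; exact Nat.cast_card_eq_zero F
  have hco : IsCoprime (n : ℤ) ((p ^ r : ℕ) : ℤ) :=
    Nat.isCoprime_iff_coprime.mpr (((Nat.coprime_primes hn hp).mpr hpn.symm).pow_right r)
  obtain ⟨u, v, huv⟩ := hco
  have := congrArg (Int.cast : ℤ → F) huv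
  push_cast at this h0
  rw [h, h0] at this
  simp at this

end SL2Count

/-- **A class multiplication coefficient of `SL(2,F_q)`.**
Let `q = p^r` be a power of an odd prime `p ∉ {3,5}` and let `a₁, a₂, a₃ ∈ SL(2,F_q)`
satisfy `a₁² = −1`, `a₂³ = −1`, `a₃⁵ = −1` and `aᵢ ∉ {1,−1}`.  Then the number of
triples `(g₁,g₂,g₃)` with `gᵢ` conjugate to `aᵢ` and `g₁g₂g₃ = −1` equals
`q(q²−1) = |SL(2,F_q)|`. -/
theorem card_conj_triples_SL2_Fq (p r : ℕ) (hp : p.Prime) (hpodd : Odd p)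
    (hp3 : p ≠ 3) (hp5 : p ≠ 5) (hr : 0 < r)
    (F : Type*) [Field F] [Fintype F] (hF : Fintype.card F = p ^ r)
    (a₁ a₂ a₃ : Matrix.SpecialLinearGroup (Fin 2) F)
    (ha₁ : ((a₁ ^ 2 : Matrix.SpecialLinearGroup (Fin 2) F) : Matrix (Fin 2) (Fin 2) F) = -1)
    (ha₂ : ((a₂ ^ 3 : Matrix.SpecialLinearGroup (Fin 2) F) : Matrix (Fin 2) (Fin 2) F) = -1)
    (ha₃ : ((a₃ ^ 5 : Matrix.SpecialLinearGroup (Fin 2) F) : Matrix (Fin 2) (Fin 2) F) = -1)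
    (ha₁1 : a₁ ≠ 1) (ha₁n : (a₁ : Matrix (Fin 2) (Fin 2) F) ≠ -1)
    (ha₂1 : a₂ ≠ 1) (ha₂n : (a₂ : Matrix (Fin 2) (Fin 2) F) ≠ -1)
    (ha₃1 : a₃ ≠ 1) (ha₃n : (a₃ : Matrix (Fin 2) (Fin 2) F) ≠ -1) :
    Nat.card {t : Matrix.SpecialLinearGroup (Fin 2) F × Matrix.SpecialLinearGroup (Fin 2) F
        × Matrix.SpecialLinearGroup (Fin 2) F //
        IsConj a₁ t.1 ∧ IsConj a₂ t.2.1 ∧ IsConj a₃ t.2.2 ∧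
        ((t.1 * t.2.1 * t.2.2 : Matrix.SpecialLinearGroup (Fin 2) F) :
          Matrix (Fin 2) (Fin 2) F) = -1} =
      p ^ r * ((p ^ r) ^ 2 - 1) := by
  have h2 : (2 : F) ≠ 0 := by
    exact_mod_cast SL2Count.natCast_ne_zero_of_card hp hF Nat.prime_two
      (by rintro rfl; exact absurd hpodd (by decide))
  have h3 : (3 : F) ≠ 0 := by
    exact_mod_cast SL2Count.natCast_ne_zero_of_card hp hF Nat.prime_three hp3
  have h5 : (5 : F) ≠ 0 := by
    exact_mod_cast SL2Count.natCast_ne_zero_of_card hp hF Nat.prime_five hp5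
  have t₁ := SL2Count.trace_of_sq ha₁ ha₁1 ha₁n
  have t₂ := SL2Count.trace_of_cube ha₂ ha₂1 ha₂n
  have t₃ := SL2Count.trace_of_fifth h2 ha₃ ha₃1 ha₃n
  obtain ⟨t, ht⟩ : ∃ t, a₃ 0 0 + a₃ 1 1 = t := ⟨_, rfl⟩
  rw [ht] at t₃
  have d₁ : (0 : F) ^ 2 ≠ 4 := fun h => mul_ne_zero h2 h2 (by linear_combination -h)
  have d₂ : (1 : F) ^ 2 ≠ 4 := fun h => h3 (by linear_combination -h)
  have ht2 : t ^ 2 - 3 ≠ 0 := fun h =>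
    one_ne_zero (α := F) (by linear_combination h - (t + 2) * (h - t₃))
  have d₃ : t ^ 2 ≠ 4 := fun h => h5 (by linear_combination h - (t + 3) * (h - t₃))
  obtain ⟨m, n, hmn⟩ := SL2Count.exists_diagonal_eq h2 one_ne_zero one_ne_zero (t ^ 2 - 3)
  rw [one_mul, one_mul] at hmn
  let P : Matrix.SpecialLinearGroup (Fin 2) F → Matrix.SpecialLinearGroup (Fin 2) F → Prop :=
    fun A B => B 0 0 + B 1 1 = 1 ∧ (A * B) 0 0 + (A * B) 1 1 = -t
  have hP : ∀ g y z, P y z ↔ P (g * y * g⁻¹) (g * z * g⁻¹) := fun g y z => by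
    have hz := SL2Count.trace_eq_of_isConj (isConj_iff.mpr ⟨g, rfl⟩ : IsConj z (g * z * g⁻¹))
    have hyz := SL2Count.trace_eq_of_isConj
      (isConj_iff.mpr ⟨g, by group⟩ : IsConj (y * z) ((g * y * g⁻¹) * (g * z * g⁻¹)))
    simp only [P, hz, hyz]
  rw [← hF, ← SL2Count.card_SL2, ← SL2Count.card_pairs_eq_card_group (SL2Count.companion 0) P hP
    ((SL2Count.stabilizerEquiv.trans (SL2Count.conicEquiv ht2 hmn)).trans
      (SL2Count.sliceEquiv h2 t).symm)]
  have hinv : ∀ A : Matrix.SpecialLinearGroup (Fin 2) F, A⁻¹ 0 0 + A⁻¹ 1 1 = A 0 0 + A 1 1 := fun A => by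
    rw [Matrix.SpecialLinearGroup.SL2_inv_expl]
    simp [add_comm]
  have hneg : ∀ A : Matrix.SpecialLinearGroup (Fin 2) F,
      (-A) 0 0 + (-A) 1 1 = -(A 0 0 + A 1 1) := fun A => by
    simp; ring
  have hprod : ∀ A B C : Matrix.SpecialLinearGroup (Fin 2) F,
      ((A * B * C : Matrix.SpecialLinearGroup (Fin 2) F) : Matrix (Fin 2) (Fin 2) F) = -1 ↔
        C = -(A * B)⁻¹ := fun A B C => by
    have h : ((A * B * C : Matrix.SpecialLinearGroup (Fin 2) F) : Matrix (Fin 2) (Fin 2) F) = -1 ↔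
      A * B * C = -1 :=
      ⟨fun h => Subtype.ext h, fun h => congrArg Subtype.val h⟩
    rw [h, ← eq_inv_mul_iff_mul_eq, mul_neg, mul_one]
  have hc := SL2Count.isConj_companion h2 a₁ t₁ d₁
  refine Nat.card_congr
    { toFun := fun w => ⟨(w.1.1, w.1.2.1), hc.trans w.2.1,
        (SL2Count.isConj_iff_trace_eq h2 t₂ d₂).mp w.2.2.1, ?_⟩
      invFun := fun w => ⟨(w.1.1, w.1.2, -(w.1.1 * w.1.2)⁻¹), hc.symm.trans w.2.1,
        (SL2Count.isConj_iff_trace_eq h2 t₂ d₂).mpr w.2.2.1,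
        (SL2Count.isConj_iff_trace_eq h2 ht d₃).mpr ?_, (hprod _ _ _).mpr rfl⟩
      left_inv := fun w => ?_
      right_inv := fun w => rfl }
  · obtain ⟨⟨A, B, C⟩, hA, hB, hC, hABC⟩ := w
    have := (SL2Count.isConj_iff_trace_eq h2 ht d₃).mp hC
    rw [(hprod _ _ _).mp hABC, hneg, hinv] at this
    linear_combination -this
  · rw [hneg, hinv, w.2.2.2, neg_neg]
  · obtain ⟨⟨A, B, C⟩, hA, hB, hC, hABC⟩ := w
    exact Subtype.ext (Prod.ext rfl (Prod.ext rfl ((hprod A B C).mp hABC).symm))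
end

section
/- Let G be a finite group, k ≥ 2 an integer, and g₁, …, g_k ∈ G with conjugacy classes C₁, …, C_k. Let (Vⱼ)ⱼ∈ι be a finite family of pairwise non-isomorphic irreducible finite-dimensional complex representations of G such that every irreducible finite-dimensional complex representation of G is isomorphic to some Vⱼ, and let χⱼ denote the character of Vⱼ. Then the number of k-tuples (x₁, …, x_k) with xᵢ ∈ Cᵢ for each i and x₁x₂⋯x_k = 1 equals (|C₁|⋯|C_k| / |G|) · Σⱼ∈ι (χⱼ(g₁)⋯χⱼ(g_k)) / χⱼ(1)^{k−2}, as an equality of complex numbers. -/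
open CategoryTheory

namespace FDRep

open scoped MonoidAlgebra

variable {G : Type} [Group G]

/-- **Schur's lemma** for endomorphisms given as linear maps. -/
lemma exists_eq_algebraMap_of_commute (V : FDRep ℂ G) [Simple V] (T : Module.End ℂ V)
    (hT : ∀ g, Commute T (V.ρ g)) : ∃ c : ℂ, T = algebraMap ℂ (Module.End ℂ V) c := by
  let F : V ⟶ V := ⟨InducedCategory.homMk (ModuleCat.ofHom T), fun g ↦ by
    ext v
    exact LinearMap.congr_fun (hT g) v⟩
  obtain ⟨c, hc⟩ := (finrank_eq_one_iff_of_nonzero' (𝟙 V) (id_nonzero V)).mp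
    (finrank_endomorphism_simple_eq_one ℂ V) F
  refine ⟨c, LinearMap.ext fun v ↦ ?_⟩
  have h := congrArg (fun φ : V ⟶ V ↦ φ.hom.hom.hom v) hc
  exact h.symm

lemma char_one_ne_zero (V : FDRep ℂ G) [Simple V] : V.character 1 ≠ 0 := by
  rw [char_one, Nat.cast_ne_zero]
  intro h
  have : Subsingleton V := Module.finrank_zero_iff.mp h
  refine id_nonzero V ?_
  ext v
  exact Subsingleton.elim (α := V) _ _

variable [Fintype G]

/-- A class function acts on an irreducible representation as a scalar. -/
lemma sum_smul_ρ_eq_algebraMap (V : FDRep ℂ G) [Simple V] (f : G → ℂ)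
    (hf : ∀ g h, f (h * g * h⁻¹) = f g) :
    ∑ g, f g • V.ρ g =
      algebraMap ℂ (Module.End ℂ V) ((∑ g, f g * V.character g) / V.character 1) := by
  obtain ⟨c, hc⟩ := V.exists_eq_algebraMap_of_commute (∑ g, f g • V.ρ g) fun h ↦ by
    rw [commute_iff_eq, Finset.sum_mul, Finset.mul_sum]
    refine Fintype.sum_equiv (MulAut.conj h⁻¹).toEquiv _ _ fun g ↦ ?_
    have hfg : f (h⁻¹ * g * h) = f g := by simpa using hf g h⁻¹
    simp [← hfg, ← map_mul, mul_assoc]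
  have htr := congrArg (LinearMap.trace ℂ V) hc
  simp only [map_sum, map_smul, smul_eq_mul, Algebra.algebraMap_eq_smul_one,
    LinearMap.trace_one] at htr
  rw [← char_one] at htr
  rw [hc, eq_div_of_mul_eq V.char_one_ne_zero htr.symm]
  rfl

lemma simple_of_isIrreducible {W : Type} [AddCommGroup W] [Module ℂ W] [FiniteDimensional ℂ W]
    (ρ : Representation ℂ G W) [ρ.IsIrreducible] : Simple (FDRep.of ρ) := by
  have hG : (Nat.card G : ℂ) ≠ 0 := NeZero.ne _
  have := invertibleOfNonzero hG
  rw [simple_iff_char_is_norm_one]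
  have h := ρ.card_inv_mul_sum_char_mul_char_eq_finrank ρ
  rw [Representation.IsIrreducible.finrank_intertwiningMap_self, Nat.cast_one,
    inv_mul_eq_one₀ hG] at h
  exact h.symm

lemma smul_eq_zero_of_forall_simple_asAlgebraHom_eq_zero {z : ℂ[G]}
    (hz : ∀ W : FDRep ℂ G, Simple W → Representation.asAlgebraHom W.ρ z = 0)
    (M : Type) [AddCommGroup M] [Module ℂ M] [Module ℂ[G] M] [IsScalarTower ℂ ℂ[G] M]
    [IsSimpleModule ℂ[G] M] (m : M) : z • m = 0 := by
  let ρ : Representation ℂ G M := Representation.ofModule' M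
  have hρ : ρ.asAlgebraHom = Algebra.lsmul ℂ ℂ M :=
    (MonoidAlgebra.lift ℂ (Module.End ℂ M) G).apply_symm_apply _
  let e : ρ.asModule ≃ₗ[ℂ[G]] M :=
    { ρ.asModuleEquiv.toAddEquiv with
      map_smul' := fun r x ↦ by
        have h := ρ.asModuleEquiv_map_smul r x
        rw [hρ] at h
        exact h }
  have : ρ.IsIrreducible :=
    (Representation.irreducible_iff_isSimpleModule_asModule ρ).mpr (IsSimpleModule.congr e)
  have : FiniteDimensional ℂ M := Module.Finite.trans ℂ[G] M
  have h := LinearMap.congr_fun (hz (FDRep.of ρ) (simple_of_isIrreducible ρ)) m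
  rwa [of_ρ', hρ] at h

/-- An element of the group algebra acting as zero on all irreducible representations is zero. -/
lemma eq_zero_of_forall_simple_sum_smul_ρ_eq_zero (f : G → ℂ)
    (hf : ∀ W : FDRep ℂ G, Simple W → ∑ g, f g • W.ρ g = 0) : f = 0 := by
  classical
  let z : ℂ[G] := ∑ g, MonoidAlgebra.single g (f g)
  have hz : z ∈ Module.jacobson ℂ[G] ℂ[G] := by
    refine Submodule.mem_sInf.mpr fun I hI ↦ ?_
    have := isSimpleModule_iff_isCoatom.mpr hI
    have h := smul_eq_zero_of_forall_simple_asAlgebraHom_eq_zero (z := z)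
      (fun W hW ↦ by simpa [z, Representation.asAlgebraHom_single] using hf W hW)
      (ℂ[G] ⧸ (I : Submodule ℂ[G] ℂ[G])) (Submodule.Quotient.mk 1)
    rwa [← Submodule.Quotient.mk_smul, smul_eq_mul, mul_one,
      Submodule.Quotient.mk_eq_zero] at h
  rw [IsSemisimpleModule.jacobson_eq_bot, Submodule.mem_bot] at hz
  funext g
  have := congrArg (fun y : ℂ[G] ↦ y.coeff g) hz
  simpa [z, Finsupp.single_apply] using this

/-- The **column orthogonality relation** for the class of the identity. -/
lemma sum_char_one_mul_char {ι : Type*} [Fintype ι] (V : ι → FDRep ℂ G)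
    (hsimple : ∀ j, Simple (V j)) (hnoniso : ∀ j j', j ≠ j' → ¬ Nonempty (V j ≅ V j'))
    (hcomplete : ∀ W : FDRep ℂ G, Simple W → ∃ j, Nonempty (W ≅ V j)) [DecidableEq G] (g : G) :
    ∑ j, (V j).character 1 * (V j).character g = if g = 1 then (Nat.card G : ℂ) else 0 := by
  classical
  have hG : (Nat.card G : ℂ) ≠ 0 := NeZero.ne _
  have := invertibleOfNonzero hG
  let f : G → ℂ := fun x ↦ (if x = 1 then (Nat.card G : ℂ) else 0) -
    ∑ j, (V j).character 1 * (V j).character x⁻¹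
  have hconj (x h : G) : f (h * x * h⁻¹) = f x := by
    have (j : ι) : (V j).character (h * x * h⁻¹)⁻¹ = (V j).character x⁻¹ := by
      rw [← (V j).char_conj x⁻¹ h]
      simp [mul_assoc]
    simp only [f, this, conj_eq_one_iff]
  have horth (i j : ι) : ∑ x, (V j).character x⁻¹ * (V i).character x =
      if j = i then (Nat.card G : ℂ) else 0 := by
    have h := char_orthonormal (V i) (V j)
    rw [inv_mul_eq_iff_eq_mul₀ hG] at h
    simp_rw [mul_comm ((V j).character _), h]
    by_cases hij : j = i
    · subst hij
      simp [Nonempty.intro (Iso.refl (V j))]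
    · simp [hij, hnoniso i j (Ne.symm hij)]
  have hf : f = 0 := by
    refine eq_zero_of_forall_simple_sum_smul_ρ_eq_zero f fun W hW ↦ ?_
    obtain ⟨i, ⟨e⟩⟩ := hcomplete W hW
    rw [W.sum_smul_ρ_eq_algebraMap f hconj, char_iso e]
    suffices h : ∑ x, f x * (V i).character x = 0 by simp [h]
    simp_rw [f, sub_mul, Finset.sum_sub_distrib, Finset.sum_mul, mul_assoc]
    rw [Finset.sum_comm]
    simp_rw [← Finset.mul_sum, horth]
    simp [mul_comm]
  have := congrFun hf g⁻¹
  simp only [f, inv_inv, inv_eq_one, Pi.zero_apply, sub_eq_zero] at this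
  exact this.symm

end FDRep

lemma List.prod_ofFn_sum_smul {R A M : Type*} [CommSemiring R] [Semiring A] [Algebra R A]
    [Monoid M] [Fintype M] (φ : M →* A) {n : ℕ} (a : Fin n → M → R) :
    (List.ofFn fun i ↦ ∑ h, a i h • φ h).prod =
      ∑ x : Fin n → M, (∏ i, a i (x i)) • φ (List.ofFn x).prod := by
  induction n with
  | zero => simp
  | succ n ih =>
    rw [List.ofFn_succ, List.prod_cons, ih, Finset.sum_mul_sum, ← Fintype.sum_prod_type',
      ← (Fin.consEquiv fun _ ↦ M).sum_comp]
    simp [Fin.prod_univ_succ, Fin.consEquiv, mul_smul_mul_comm]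

/-- **Generalized Frobenius character sum formula.**
Let `G` be a finite group, `k ≥ 2`, and `g₁,…,g_k ∈ G` with conjugacy classes
`C₁,…,C_k`.  If `(Vⱼ)` is a complete family of pairwise non-isomorphic irreducible
finite-dimensional complex representations of `G` with characters `χⱼ`, then the number
of tuples `(x₁,…,x_k)` with `xᵢ ∈ Cᵢ` and `x₁⋯x_k = 1` equals
`(|C₁|⋯|C_k|/|G|)·Σⱼ χⱼ(g₁)⋯χⱼ(g_k)/χⱼ(1)^{k−2}`. -/
theorem frobenius_character_sum_formula (G : Type) [Group G] [Fintype G]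
    (k : ℕ) (hk : 2 ≤ k) (g : Fin k → G)
    (ι : Type) [Fintype ι] (V : ι → FDRep ℂ G)
    (hsimple : ∀ j, Simple (V j))
    (hnoniso : ∀ j j', j ≠ j' → ¬ Nonempty (V j ≅ V j'))
    (hcomplete : ∀ W : FDRep ℂ G, Simple W → ∃ j, Nonempty (W ≅ V j)) :
    (Nat.card {x : Fin k → G // (∀ i, IsConj (g i) (x i)) ∧ (List.ofFn x).prod = 1} : ℂ) =
      (∏ i, (Nat.card {h : G // IsConj (g i) h} : ℂ)) / (Nat.card G : ℂ) *
        ∑ j, (∏ i, (V j).character (g i)) / ((V j).character 1) ^ (k - 2) := by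
  classical
  have hG : (Nat.card G : ℂ) ≠ 0 := NeZero.ne _
  let a (i : Fin k) (h : G) : ℂ := if IsConj (g i) h then 1 else 0
  let c (i : Fin k) : ℂ := (Nat.card {h : G // IsConj (g i) h} : ℂ)
  have ha (i : Fin k) (x h : G) : a i (h * x * h⁻¹) = a i x := by
    have hx : IsConj x (h * x * h⁻¹) := isConj_iff.mpr ⟨h, rfl⟩
    have : IsConj (g i) (h * x * h⁻¹) ↔ IsConj (g i) x :=
      ⟨fun H ↦ H.trans hx.symm, fun H ↦ H.trans hx⟩
    simp only [a, this]
  have hchar (i : Fin k) (j : ι) :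
      ∑ x, a i x * (V j).character x = c i * (V j).character (g i) := by
    have (x : G) : a i x * (V j).character x = a i x * (V j).character (g i) := by
      by_cases hx : IsConj (g i) x
      · obtain ⟨h, rfl⟩ := isConj_iff.mp hx
        rw [FDRep.char_conj]
      · simp only [a, if_neg hx, zero_mul]
    simp_rw [this, ← Finset.sum_mul]
    simp [a, c, Fintype.card_subtype]
  have key (j : ι) : ∑ x : Fin k → G, (∏ i, a i (x i)) * (V j).character (List.ofFn x).prod =
      (∏ i, c i * (V j).character (g i) / (V j).character 1) * (V j).character 1 := by
    have := hsimple j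
    have h := List.prod_ofFn_sum_smul (V j).ρ a
    simp_rw [(V j).sum_smul_ρ_eq_algebraMap _ (ha _), hchar] at h
    have h' := congrArg (LinearMap.trace ℂ (V j)) h
    rw [← Function.comp_def (algebraMap ℂ (Module.End ℂ (V j))), ← List.map_ofFn,
      ← map_list_prod, List.prod_ofFn] at h'
    simpa [Algebra.algebraMap_eq_smul_one, FDRep.character] using h'.symm
  have hcount : (Nat.card {x : Fin k → G //
      (∀ i, IsConj (g i) (x i)) ∧ (List.ofFn x).prod = 1} : ℂ) * Nat.card G =
      ∑ x : Fin k → G, (∏ i, a i (x i)) * ∑ j, (V j).character 1 *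
        (V j).character (List.ofFn x).prod := by
    simp only [FDRep.sum_char_one_mul_char V hsimple hnoniso hcomplete, a,
      Finset.prod_boole, mul_ite, ite_mul, mul_zero, zero_mul, one_mul, ← ite_and]
    rw [← Finset.sum_filter]
    simp [-isConj_iff, Fintype.card_subtype, and_comm]
  rw [div_mul_eq_mul_div, eq_div_iff hG, hcount]
  simp_rw [Finset.mul_sum, mul_left_comm _ ((V _).character 1)]
  rw [Finset.sum_comm]
  simp_rw [← Finset.mul_sum, key]
  rw [Finset.mul_sum]
  refine Finset.sum_congr rfl fun j _ ↦ ?_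
  have := hsimple j
  have h1 := (V j).char_one_ne_zero
  obtain ⟨m, rfl⟩ := Nat.exists_eq_add_of_le' hk
  rw [Finset.prod_div_distrib, Finset.prod_mul_distrib, Finset.prod_const, Finset.card_univ,
    Fintype.card_fin, Nat.add_sub_cancel]
  simp only [c]
  field_simp
  ring
end

section
/- Let q be a power of an odd prime, and let r be an even positive integer. If A ∈ SL(2,F_q) satisfies A^{qʳ + 1} = 1, then A = 1 or A = −1. -/
theorem Matrix.SpecialLinearGroup.eq_one_or_neg_one_of_sq_eq_one {F : Type*} [Field F]
    (h2 : (2 : F) ≠ 0) (A : Matrix.SpecialLinearGroup (Fin 2) F) (hA : A ^ 2 = 1) :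
    A = 1 ∨ (A : Matrix (Fin 2) (Fin 2) F) = -1 := by
  have hinv : A = A⁻¹ := by
    rw [eq_inv_iff_mul_eq_one, ← sq, hA]
  have hM : (A : Matrix (Fin 2) (Fin 2) F) = Matrix.adjugate A := by
    conv_lhs => rw [hinv]
    exact Matrix.SpecialLinearGroup.coe_inv A
  have hdet := A.det_coe
  rw [Matrix.det_fin_two] at hdet
  rw [Matrix.adjugate_fin_two] at hM
  have h00 : A 0 0 = A 1 1 := by simpa using congr_fun₂ hM 0 0
  have h01 : A 0 1 = 0 := by
    have h : A 0 1 = -A 0 1 := by simpa using congr_fun₂ hM 0 1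
    exact (mul_eq_zero.mp (by linear_combination h : (2 : F) * A 0 1 = 0)).resolve_left h2
  have h10 : A 1 0 = 0 := by
    have h : A 1 0 = -A 1 0 := by simpa using congr_fun₂ hM 1 0
    exact (mul_eq_zero.mp (by linear_combination h : (2 : F) * A 1 0 = 0)).resolve_left h2
  rw [h01, h00, zero_mul, sub_zero, mul_self_eq_one_iff] at hdet
  refine hdet.imp (fun h => ?_) (fun h => ?_)
  · ext i j
    fin_cases i <;> fin_cases j <;> simp [h00, h01, h10, h]
  · ext i j
    fin_cases i <;> fin_cases j <;> simp [h00, h01, h10, h]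

/-- For odd `q` and even `r`, half of `q ^ r + 1` is prime to the order of `GL(2, F_q)`. -/
theorem Nat.exists_coprime_two_mul_eq_pow_add_one {q r : ℕ} (hq : Odd q) (hr : 0 < r)
    (hreven : Even r) :
    ∃ k, q ^ r + 1 = 2 * k ∧ Nat.Coprime k ((q ^ 2 - 1) * (q ^ 2 - q)) := by
  obtain ⟨s, rfl⟩ := hreven.two_dvd
  have hsq : (q ^ s) ^ 2 % 4 = 1 := by
    obtain ⟨t, ht⟩ := hq.pow (n := s)
    rw [ht, show (2 * t + 1) ^ 2 = 4 * (t ^ 2 + t) + 1 by ring]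
    omega
  rw [← pow_mul, mul_comm] at hsq
  obtain ⟨k, hk⟩ : 2 ∣ q ^ (2 * s) + 1 := by omega
  have hkodd : Odd k := by rw [Nat.odd_iff]; omega
  have hdvd : q ^ 2 - 1 ∣ q ^ (2 * s) - 1 := by
    simpa [pow_mul] using Nat.sub_dvd_pow_sub_pow (q ^ 2) 1 s
  have h1 : Nat.Coprime k (q ^ 2 - 1) := by
    have ha : k.gcd (q ^ 2 - 1) ∣ 2 := by
      have h := Nat.dvd_sub ((Nat.gcd_dvd_left k (q ^ 2 - 1)).mul_left 2)
        ((Nat.gcd_dvd_right k (q ^ 2 - 1)).trans hdvd)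
      rwa [show 2 * k - (q ^ (2 * s) - 1) = 2 by omega] at h
    exact Nat.dvd_one.mp (((Nat.coprime_two_right.mpr hkodd).coprime_dvd_left
      (Nat.gcd_dvd_left _ _)).dvd_of_dvd_mul_left (by simpa using ha))
  have h2 : Nat.Coprime k q := by
    have ha : k.gcd q ∣ 1 := (Nat.dvd_add_right
      ((Nat.gcd_dvd_right k q).trans (dvd_pow_self q hr.ne'))).mp
      (hk ▸ (Nat.gcd_dvd_left k q).mul_left 2)
    exact Nat.dvd_one.mp ha
  refine ⟨k, hk, h1.mul_right ?_⟩
  have h3 : q ^ 2 - q = q * (q - 1) := by rw [Nat.mul_sub, sq, mul_one]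
  rw [h3]
  refine h2.mul_right (h1.coprime_dvd_right ?_)
  simpa using Nat.sub_dvd_pow_sub_pow q 1 2

/-- **`(qʳ+1)`-torsion in `SL(2,F_q)` for even `r` is central.**
Let `q = p^m` be a power of an odd prime and `r` an even positive integer.  If
`A ∈ SL(2,F_q)` satisfies `A^{qʳ+1} = 1`, then `A = 1` or `A = −1`. -/
theorem eq_one_or_neg_one_of_pow_q_pow_even_add_one (p m r : ℕ)
    (hp : p.Prime) (hpodd : Odd p) (hm : 0 < m) (hr : 0 < r) (hreven : Even r)
    (F : Type*) [Field F] [Fintype F] (hF : Fintype.card F = p ^ m)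
    (A : Matrix.SpecialLinearGroup (Fin 2) F)
    (hA : A ^ ((p ^ m) ^ r + 1) = 1) :
    A = 1 ∨ (A : Matrix (Fin 2) (Fin 2) F) = -1 := by
  have hq : Odd (p ^ m) := hpodd.pow
  have h2 : (2 : F) ≠ 0 := by
    refine Ring.two_ne_zero fun h => ?_
    have := FiniteField.even_card_of_char_two h
    rw [hF, Nat.odd_iff.mp hq] at this
    exact one_ne_zero this
  obtain ⟨k, hk, hcop⟩ := Nat.exists_coprime_two_mul_eq_pow_add_one hq hr hreven
  apply Matrix.SpecialLinearGroup.eq_one_or_neg_one_of_sq_eq_one h2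
  rw [hk, pow_mul] at hA
  apply Matrix.SpecialLinearGroup.toGL_injective
  rw [map_one]
  set B := Matrix.SpecialLinearGroup.toGL (A ^ 2) with hB
  have hBk : B ^ k = 1 := by rw [hB, ← map_pow, hA, map_one]
  have hcard : orderOf B ∣ ((p ^ m) ^ 2 - 1) * ((p ^ m) ^ 2 - p ^ m) := by
    have h := orderOf_dvd_natCard B
    rw [Matrix.card_GL_field] at h
    simpa [Fin.prod_univ_two, hF] using h
  exact orderOf_eq_one_iff.mp
    (Nat.eq_one_of_dvd_coprimes hcop (orderOf_dvd_of_pow_eq_one hBk) hcard)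
end

section
/- Let E be a finite field of odd characteristic and F ⊆ E a subfield such that the degree [E : F] is odd. Let x ∈ SL(2,E) be a matrix all of whose entries lie in F, with x ≠ 1 and x ≠ −1. If g ∈ SL(2,E) is such that g⁻¹ x g is a diagonal matrix, then there exist h ∈ SL(2,E) all of whose entries lie in F and a diagonal matrix t ∈ SL(2,E) such that g = h·t. -/
/-- An element of an extension of odd degree that is a root of a monic quadratic over the base
subfield lies in the base subfield. -/
theorem Subfield.mem_of_odd_finrank_of_quadratic {E : Type*} [Field E] (F : Subfield E)
    (hdeg : Odd (Module.finrank F E)) {b c a : E} (hb : b ∈ F) (hc : c ∈ F)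
    (h : a ^ 2 + b * a + c = 0) : a ∈ F := by
  open Polynomial in
  have : FiniteDimensional F E := Module.finite_of_finrank_pos hdeg.pos
  have hdvd : (minpoly F a).natDegree ∣ Module.finrank F E :=
    minpoly.degree_dvd (Algebra.IsIntegral.isIntegral a)
  have hle : (minpoly F a).natDegree ≤ 2 := by
    let P : F[X] := C 1 * X ^ 2 + C ⟨b, hb⟩ * X + C ⟨c, hc⟩
    have hP : P.natDegree = 2 := natDegree_quadratic one_ne_zero
    have hroot : aeval a P = 0 := by
      simp only [P, map_add, map_mul, map_pow, aeval_C, aeval_X, map_one, one_mul]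
      exact h
    rw [← hP]
    refine natDegree_le_natDegree (minpoly.min F a ?_ hroot)
    exact leadingCoeff_quadratic one_ne_zero
  have hpos : 0 < (minpoly F a).natDegree :=
    minpoly.natDegree_pos (Algebra.IsIntegral.isIntegral a)
  have hone : (minpoly F a).natDegree = 1 := by
    have := hdeg.of_dvd_nat hdvd
    rcases this with ⟨k, hk⟩
    omega
  obtain ⟨y, rfl⟩ := (minpoly.natDegree_eq_one_iff).1 hone
  exact y.2

/-- An eigenvector of a non-scalar `2 × 2` matrix over a subfield, with eigenvalue in the
subfield, is proportional to a vector over the subfield. -/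
theorem Subfield.exists_eigenvector_eq_mul {E : Type*} [Field E] (F : Subfield E)
    {A B C D a p r : E} (hA : A ∈ F) (hB : B ∈ F) (hC : C ∈ F) (hD : D ∈ F) (ha : a ∈ F)
    (hx : ¬(B = 0 ∧ C = 0 ∧ A = D)) (h1 : A * p + B * r = a * p) (h2 : C * p + D * r = a * r)
    (hpr : p ≠ 0 ∨ r ≠ 0) :
    ∃ l v w : E, l ≠ 0 ∧ v ∈ F ∧ w ∈ F ∧ p = l * v ∧ r = l * w := by
  by_cases hp : p = 0
  · exact ⟨r, 0, 1, by simpa [hp] using hpr, F.zero_mem, F.one_mem, by simp [hp], by simp⟩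
  by_cases hB0 : B = 0
  · have hAa : A = a := mul_right_cancel₀ hp (by simpa [hB0] using h1)
    by_cases hDa : D = a
    · refine absurd ⟨hB0, ?_, hAa.trans hDa.symm⟩ hx
      have : C * p = 0 := by linear_combination h2 - r * hDa
      simpa [hp] using this
    · have hne : a - D ≠ 0 := sub_ne_zero.2 (Ne.symm hDa)
      refine ⟨p, 1, C / (a - D), hp, F.one_mem, F.div_mem hC (F.sub_mem ha hD), by simp, ?_⟩
      field_simp
      linear_combination -h2
  · refine ⟨p, 1, (a - A) / B, hp, F.one_mem, F.div_mem (F.sub_mem ha hA) hB, by simp, ?_⟩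
    field_simp
    linear_combination h1


/-- **Diagonalizing matrices can be chosen over the base field, up to a diagonal factor.**
Let `E` be a finite field of odd characteristic and `F ⊆ E` a subfield of odd degree.
If `x ∈ SL(2,E)` has all entries in `F`, `x ≠ ±1`, and `g ∈ SL(2,E)` is such that
`g⁻¹xg` is diagonal, then `g = h·t` with `h ∈ SL(2,E)` having all entries in `F` and
`t` diagonal. -/
theorem diagonalizer_eq_rational_mul_diagonal (E : Type*) [Field E] [Finite E]
    (hchar : Odd (ringChar E)) (F : Subfield E) (hdeg : Odd (Module.finrank F E))
    (x : Matrix.SpecialLinearGroup (Fin 2) E)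
    (hxF : ∀ i j, (x : Matrix (Fin 2) (Fin 2) E) i j ∈ F)
    (hx1 : x ≠ 1) (hxneg : (x : Matrix (Fin 2) (Fin 2) E) ≠ -1)
    (g : Matrix.SpecialLinearGroup (Fin 2) E)
    (hg : Matrix.IsDiag
      ((g⁻¹ * x * g : Matrix.SpecialLinearGroup (Fin 2) E) : Matrix (Fin 2) (Fin 2) E)) :
    ∃ h t : Matrix.SpecialLinearGroup (Fin 2) E,
      (∀ i j, (h : Matrix (Fin 2) (Fin 2) E) i j ∈ F) ∧
      Matrix.IsDiag ((t : Matrix.SpecialLinearGroup (Fin 2) E) : Matrix (Fin 2) (Fin 2) E) ∧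
      g = h * t := by
  have hmul : (x : Matrix (Fin 2) (Fin 2) E) * (g : Matrix (Fin 2) (Fin 2) E) =
      g * ((g⁻¹ * x * g : Matrix.SpecialLinearGroup (Fin 2) E) : Matrix (Fin 2) (Fin 2) E) := by
    rw [← Matrix.SpecialLinearGroup.coe_mul, ← Matrix.SpecialLinearGroup.coe_mul]
    rw [mul_assoc g⁻¹, mul_inv_cancel_left]
  have hdet := (g⁻¹ * x * g).det_coe
  generalize ((g⁻¹ * x * g : Matrix.SpecialLinearGroup (Fin 2) E) :
    Matrix (Fin 2) (Fin 2) E) = y at hg hmul hdet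
  have h01 : y 0 1 = 0 := hg (by decide)
  have h10 : y 1 0 = 0 := hg (by decide)
  rw [Matrix.det_fin_two, h01, zero_mul, sub_zero] at hdet
  have e00 := congrFun (congrFun hmul 0) 0
  have e01 := congrFun (congrFun hmul 0) 1
  have e10 := congrFun (congrFun hmul 1) 0
  have e11 := congrFun (congrFun hmul 1) 1
  simp only [Matrix.mul_apply, Fin.sum_univ_two, h01, h10, mul_zero, add_zero, zero_add]
    at e00 e01 e10 e11
  have hgdet := g.det_coe
  have hxdet := x.det_coe
  rw [Matrix.det_fin_two] at hgdet hxdet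
  have hns : ¬(x 0 1 = 0 ∧ x 1 0 = 0 ∧ x 0 0 = x 1 1) := by
    rintro ⟨hb, hc, had⟩
    rw [hb, zero_mul, sub_zero, had, mul_self_eq_one_iff] at hxdet
    rcases hxdet with h | h
    · apply hx1
      ext i j
      fin_cases i <;> fin_cases j <;> simp [hb, hc, had, h]
    · apply hxneg
      ext i j
      fin_cases i <;> fin_cases j <;> simp [hb, hc, had, h]
  have htr : y 0 0 + y 1 1 = x 0 0 + x 1 1 := by
    linear_combination (-(y 0 0 + y 1 1) + x 0 0 + x 1 1) * hgdet - g 1 1 * e00 + g 1 0 * e01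
      + g 0 1 * e10 - g 0 0 * e11
  have ha : y 0 0 ∈ F := F.mem_of_odd_finrank_of_quadratic hdeg
    (F.neg_mem (F.add_mem (hxF 0 0) (hxF 1 1))) F.one_mem
    (by linear_combination y 0 0 * htr - hdet)
  have hd : y 1 1 ∈ F := by
    rw [eq_sub_of_add_eq' htr]
    exact F.sub_mem (F.add_mem (hxF 0 0) (hxF 1 1)) ha
  obtain ⟨l, v₀, v₁, hl, hv₀, hv₁, hg00, hg10⟩ := F.exists_eigenvector_eq_mul (hxF 0 0) (hxF 0 1)
    (hxF 1 0) (hxF 1 1) ha hns (by rw [e00, mul_comm]) (by rw [e10, mul_comm])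
    (by by_contra! h; simp [h.1, h.2] at hgdet)
  obtain ⟨m, w₀, w₁, -, hw₀, hw₁, hg01, hg11⟩ := F.exists_eigenvector_eq_mul (hxF 0 0) (hxF 0 1)
    (hxF 1 0) (hxF 1 1) hd hns (by rw [e01, mul_comm]) (by rw [e11, mul_comm])
    (by by_contra! h; simp [h.1, h.2] at hgdet)
  rw [hg00, hg01, hg10, hg11] at hgdet
  have hlm : l * m ∈ F := by
    have h : l * m * (v₀ * w₁ - w₀ * v₁) = 1 := by linear_combination hgdet
    rw [eq_inv_of_mul_eq_one_left h]
    exact F.inv_mem (F.sub_mem (F.mul_mem hv₀ hw₁) (F.mul_mem hw₀ hv₁))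
  have hfactor : (g : Matrix (Fin 2) (Fin 2) E) =
      !![v₀, l * m * w₀; v₁, l * m * w₁] * !![l, 0; 0, l⁻¹] := by
    rw [Matrix.eta_fin_two (g : Matrix (Fin 2) (Fin 2) E), hg00, hg01, hg10, hg11,
      Matrix.mul_fin_two]
    ext i j
    fin_cases i <;> fin_cases j <;> simp <;> field_simp
  refine ⟨⟨!![v₀, l * m * w₀; v₁, l * m * w₁], ?_⟩, ⟨!![l, 0; 0, l⁻¹], ?_⟩, ?_, ?_, ?_⟩
  · rw [Matrix.det_fin_two_of]
    linear_combination hgdet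
  · rw [Matrix.det_fin_two_of]
    simp [hl]
  · intro i j
    fin_cases i <;> fin_cases j <;> simp [hv₀, hv₁, F.mul_mem hlm hw₀, F.mul_mem hlm hw₁]
  · intro i j hij
    fin_cases i <;> fin_cases j <;> simp_all
  · exact Subtype.ext hfactor
end

section
/- Let q be a power of an odd prime and r an odd positive integer. If x ∈ SL(2,F_q) satisfies x^{qʳ − 1} = 1 and x ∉ {1, −1}, then x is conjugate within SL(2,F_q) to a diagonal matrix, i.e. there exists h ∈ SL(2,F_q) such that h x h⁻¹ is diagonal. -/
namespace Matrix

theorem isDiag_fin_two {R : Type*} [Zero R] {M : Matrix (Fin 2) (Fin 2) R}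
    (h01 : M 0 1 = 0) (h10 : M 1 0 = 0) : M.IsDiag := by
  intro i j hij
  fin_cases i <;> fin_cases j <;> simp_all

/-- Twice the traceless part of a `2 × 2` matrix squares to the discriminant. -/
theorem two_smul_sub_trace_sq_fin_two {R : Type*} [CommRing R] (A : Matrix (Fin 2) (Fin 2) R) :
    ((2 : R) • A - A.trace • (1 : Matrix (Fin 2) (Fin 2) R)) ^ 2 =
      (A.trace ^ 2 - 4 * A.det) • (1 : Matrix (Fin 2) (Fin 2) R) := by
  ext i j
  fin_cases i <;> fin_cases j <;>
    simp [pow_two, Matrix.mul_apply, Fin.sum_univ_two, trace_fin_two, det_fin_two] <;> ring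

namespace SpecialLinearGroup

/-- A matrix in `SL(2, F)` whose discriminant is a nonzero square is conjugate in `SL(2, F)` to a
diagonal matrix. -/
theorem exists_conj_isDiag_of_disc_eq_sq {F : Type*} [Field F] (h2 : (2 : F) ≠ 0)
    (x : SpecialLinearGroup (Fin 2) F) {s : F} (hs : s ≠ 0)
    (hd : (x : Matrix (Fin 2) (Fin 2) F).trace ^ 2 - 4 = s * s) :
    ∃ h : SpecialLinearGroup (Fin 2) F,
      IsDiag ((h * x * h⁻¹ : SpecialLinearGroup (Fin 2) F) : Matrix (Fin 2) (Fin 2) F) := by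
  have hdet := x.det_coe
  rw [det_fin_two] at hdet
  rw [trace_fin_two] at hd
  -- It suffices that both rows of `h` are isotropic for the binary quadratic form below.
  suffices H : ∃ u v w z : F, u * z - v * w = 1 ∧
      x.1 0 1 * u ^ 2 - (x.1 0 0 - x.1 1 1) * u * v - x.1 1 0 * v ^ 2 = 0 ∧
      x.1 0 1 * w ^ 2 - (x.1 0 0 - x.1 1 1) * w * z - x.1 1 0 * z ^ 2 = 0 by
    obtain ⟨u, v, w, z, h1, hu, hw⟩ := H
    obtain ⟨g, hg⟩ : ∃ g : SpecialLinearGroup (Fin 2) F, g.1 = !![u, v; w, z] :=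
      ⟨⟨!![u, v; w, z], by rw [det_fin_two_of, h1]⟩, rfl⟩
    refine ⟨g, isDiag_fin_two ?_ ?_⟩
    · rw [coe_mul, coe_mul, coe_inv, hg]
      simp only [mul_apply, Fin.sum_univ_two, adjugate_fin_two, of_apply, cons_val]
      linear_combination hu
    · rw [coe_mul, coe_mul, coe_inv, hg]
      simp only [mul_apply, Fin.sum_univ_two, adjugate_fin_two, of_apply, cons_val]
      linear_combination -hw
  generalize x.1 0 0 = a at *
  generalize x.1 0 1 = b at *
  generalize x.1 1 0 = c at *
  generalize x.1 1 1 = e at *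
  have hd' : (a - e) ^ 2 + 4 * b * c = s * s := by linear_combination hd - 4 * hdet
  by_cases hb : b = 0
  · subst hb
    have hae : a - e ≠ 0 := by
      intro h
      apply hs
      simpa [h] using hd'.symm
    refine ⟨(a - e)⁻¹, 0, -c, a - e, ?_, ?_, ?_⟩
    · field_simp
      ring
    · ring
    · ring
  · have h4 : 4 * b * s ≠ 0 := by
      have : (4 : F) = 2 * 2 := by norm_num
      rw [this]
      simp [h2, hb, hs]
    refine ⟨(a - e + s) * (4 * b * s)⁻¹, 2 * b * (4 * b * s)⁻¹, a - e - s, 2 * b, ?_, ?_, ?_⟩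
    · linear_combination mul_inv_cancel₀ h4
    · linear_combination (-b * (4 * b * s)⁻¹ ^ 2) * hd'
    · linear_combination (-b) * hd'

end SpecialLinearGroup

end Matrix

/-- In a finite field of odd cardinality `q`, a nonzero `a` with `a ^ ((q ^ r - 1) / 2) = 1` for
some odd `r` is a square. -/
theorem FiniteField.isSquare_of_pow_half_card_pow_eq_one {F : Type*} [Field F] [Fintype F]
    (hF : ringChar F ≠ 2) {a : F} (ha : a ≠ 0) {r : ℕ} (hr : Odd r)
    (h : a ^ (Fintype.card F ^ r / 2) = 1) : IsSquare a := by
  rw [FiniteField.isSquare_iff hF ha]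
  have hq : Odd (Fintype.card F) := Nat.odd_iff.mpr (FiniteField.odd_card_of_char_ne_two hF)
  obtain ⟨k, hk⟩ := hq
  have hodd : Odd (∑ i ∈ Finset.range r, Fintype.card F ^ i) := by
    rw [Finset.odd_sum_iff_odd_card_odd, Finset.filter_true_of_mem
      fun i _ => Odd.pow ⟨k, hk⟩, Finset.card_range]
    exact hr
  have hhalf : Fintype.card F ^ r / 2 =
      Fintype.card F / 2 * ∑ i ∈ Finset.range r, Fintype.card F ^ i := by
    have hgeom : (2 * k) * ∑ i ∈ Finset.range r, Fintype.card F ^ i + 1 = Fintype.card F ^ r := by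
      have := mul_geom_sum (Fintype.card F : ℤ) r
      have hk' : (Fintype.card F : ℤ) - 1 = 2 * k := by rw [hk]; push_cast; ring
      rw [hk'] at this
      zify
      linear_combination this
    rw [show Fintype.card F / 2 = k by omega, ← hgeom, mul_assoc]
    omega
  rcases FiniteField.pow_dichotomy hF ha with h1 | h1
  · exact h1
  · rw [hhalf, pow_mul, h1, hodd.neg_one_pow] at h
    rw [h1, h]

/-- **`(qʳ−1)`-torsion in `SL(2,F_q)` for odd `r` is diagonalizable over `F_q`.**
Let `q = p^m` be a power of an odd prime and `r` an odd positive integer.  If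
`x ∈ SL(2,F_q)` satisfies `x^{qʳ−1} = 1` and `x ∉ {1,−1}`, then `x` is conjugate in
`SL(2,F_q)` to a diagonal matrix. -/
theorem isConj_diagonal_of_pow_q_pow_odd_sub_one (p m r : ℕ)
    (hp : p.Prime) (hpodd : Odd p) (hm : 0 < m) (hr : 0 < r) (hrodd : Odd r)
    (F : Type*) [Field F] [Fintype F] (hF : Fintype.card F = p ^ m)
    (x : Matrix.SpecialLinearGroup (Fin 2) F)
    (hx : x ^ ((p ^ m) ^ r - 1) = 1)
    (hx1 : x ≠ 1) (hxneg : (x : Matrix (Fin 2) (Fin 2) F) ≠ -1) :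
    ∃ h : Matrix.SpecialLinearGroup (Fin 2) F,
      Matrix.IsDiag
        ((h * x * h⁻¹ : Matrix.SpecialLinearGroup (Fin 2) F) : Matrix (Fin 2) (Fin 2) F) := by
  have : Fact p.Prime := ⟨hp⟩
  have : CharP F p := charP_of_card_eq_prime_pow hF
  have hp2 : p ≠ 2 := by
    rintro rfl
    exact absurd hpodd (by decide)
  have hchar : ringChar F ≠ 2 := by rwa [ringChar.eq F p]
  have h2 : (2 : F) ≠ 0 := Ring.two_ne_zero hchar
  set A : Matrix (Fin 2) (Fin 2) F := x.1 with hA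
  have hdet : A.det = 1 := x.det_coe
  set B : Matrix (Fin 2) (Fin 2) F := (2 : F) • A - A.trace • 1 with hB
  set d : F := A.trace ^ 2 - 4 with hd
  have hB2 : B ^ 2 = d • (1 : Matrix (Fin 2) (Fin 2) F) := by
    rw [hB, Matrix.two_smul_sub_trace_sq_fin_two, hdet, mul_one]
  have hpow_pos : 0 < (p ^ m) ^ r := by have := hp.pos; positivity
  have hApow : A ^ (p ^ m) ^ r = A := by
    have hxq : x ^ (p ^ m) ^ r = x := by
      rw [← Nat.sub_add_cancel hpow_pos, pow_succ, hx, one_mul]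
    rw [hA, ← Matrix.SpecialLinearGroup.coe_pow, hxq]
  have hscalar (c : F) : c ^ (p ^ m) ^ r = c := by rw [← hF, FiniteField.pow_card_pow]
  have hBpow : B ^ (p ^ m) ^ r = B := by
    have hcomm : Commute ((2 : F) • A) (A.trace • (1 : Matrix (Fin 2) (Fin 2) F)) :=
      (Commute.one_right _).smul_right _
    rw [hB, ← pow_mul, sub_pow_char_pow_of_commute p (m * r) hcomm, pow_mul, smul_pow, smul_pow,
      hApow, hscalar, hscalar, one_pow]
  have hB0 : B ≠ 0 := by
    intro h0
    have hd0 : A.trace ^ 2 = 4 := by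
      rw [h0] at hB2
      have := congrFun (congrFun hB2 0) 0
      simp at this
      exact sub_eq_zero.mp this.symm
    have hfac : (A.trace - 2) * (A.trace + 2) = 0 := by linear_combination hd0
    have hAt : (2 : F) • A = A.trace • 1 := sub_eq_zero.mp h0
    rcases mul_eq_zero.mp hfac with h | h
    · rw [sub_eq_zero.mp h] at hAt
      exact hx1 (Subtype.ext (smul_right_injective _ h2 hAt))
    · rw [eq_neg_of_add_eq_zero_left h, neg_smul, ← smul_neg] at hAt
      exact hxneg (smul_right_injective _ h2 hAt)
  have hqodd : Odd ((p ^ m) ^ r) := hpodd.pow.pow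
  have hdpow : d ^ ((p ^ m) ^ r / 2) = 1 := by
    rw [← Nat.two_mul_div_two_add_one_of_odd hqodd, pow_succ, pow_mul, hB2, smul_pow, one_pow,
      smul_one_mul] at hBpow
    exact smul_left_injective F hB0 (by simpa using hBpow)
  have hd0 : d ≠ 0 := by
    intro h0
    rw [h0, zero_pow_eq_one₀] at hdpow
    have : 2 < (p ^ m) ^ r := by
      have h1 : 2 < p := lt_of_le_of_ne hp.two_le hp2.symm
      exact h1.trans_le ((Nat.le_self_pow hm.ne' p).trans (Nat.le_self_pow hr.ne' _))
    omega
  obtain ⟨s, hs⟩ := FiniteField.isSquare_of_pow_half_card_pow_eq_one hchar hd0 hrodd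
    (by rwa [hF])
  refine x.exists_conj_isDiag_of_disc_eq_sq h2 (s := s) ?_ hs
  rintro rfl
  exact hd0 (by simpa using hs)
end

section
/- Let G be a group and A an abelian group written multiplicatively. Let ω : G × G × G → A be a normalized 3-cocycle, i.e. ω(g₂,g₃,g₄)·ω(g₁,g₂g₃,g₄)·ω(g₁,g₂,g₃) = ω(g₁g₂,g₃,g₄)·ω(g₁,g₂,g₃g₄) for all g₁,g₂,g₃,g₄ ∈ G, and ω(1,g,h) = ω(g,1,h) = ω(g,h,1) = 1 for all g,h ∈ G. For a ∈ G define β_a(g,h) = ω(a,g,h)·ω(g,h,(gh)⁻¹a(gh))·ω(g, g⁻¹ag, h)⁻¹. Then for all a, g, h, k ∈ G one has β_a(g,h)·β_a(gh,k) = β_a(g,hk)·β_{g⁻¹ag}(h,k). -/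
/-- The twisted 2-cochain `β_a` associated to a 3-cochain `ω` on a group `G` with
values in an abelian group `A`:
`β_a(g,h) = ω(a,g,h)·ω(g,h,(gh)⁻¹a(gh))·ω(g,g⁻¹ag,h)⁻¹`. -/
def betaTwist {G A : Type*} [Group G] [CommGroup A]
    (ω : G → G → G → A) (a g h : G) : A :=
  ω a g h * ω g h ((g * h)⁻¹ * a * (g * h)) * (ω g (g⁻¹ * a * g) h)⁻¹

/-- **The `β_a` are twisted 2-cocycles.**
If `ω` is a normalized 3-cocycle on `G` with values in an abelian group `A`, then for
all `a, g, h, k ∈ G` one has `β_a(g,h)·β_a(gh,k) = β_a(g,hk)·β_{g⁻¹ag}(h,k)`. -/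
theorem betaTwist_twisted_cocycle {G A : Type*} [Group G] [CommGroup A]
    (ω : G → G → G → A)
    (hcoc : ∀ g₁ g₂ g₃ g₄ : G,
      ω g₂ g₃ g₄ * ω g₁ (g₂ * g₃) g₄ * ω g₁ g₂ g₃ =
        ω (g₁ * g₂) g₃ g₄ * ω g₁ g₂ (g₃ * g₄))
    (hnorm₁ : ∀ g h : G, ω 1 g h = 1)
    (hnorm₂ : ∀ g h : G, ω g 1 h = 1)
    (hnorm₃ : ∀ g h : G, ω g h 1 = 1) :
    ∀ a g h k : G,
      betaTwist ω a g h * betaTwist ω a (g * h) k =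
        betaTwist ω a g (h * k) * betaTwist ω (g⁻¹ * a * g) h k := by
  intro a g h k
  have conj_mul (x y : G) : y * (y⁻¹ * x * y) = x * y := by group
  have conj_conj (x y z : G) : (y * z)⁻¹ * x * (y * z) = z⁻¹ * (y⁻¹ * x * y) * z := by group
  unfold betaTwist
  rw [← mul_assoc g h k]
  simp only [conj_conj]
  set b := g⁻¹ * a * g with hb
  set c := h⁻¹ * b * h with hc
  set d := k⁻¹ * c * k with hd
  have h₁ := hcoc a g h k
  have h₂ := hcoc g b h k
  have h₃ := hcoc g h c k
  have h₄ := hcoc g h k d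
  rw [← conj_mul a g, ← hb] at h₁
  rw [← conj_mul b h, ← hc] at h₂
  rw [← conj_mul c k, ← hd] at h₃
  apply Additive.ofMul.injective
  apply_fun Additive.ofMul at h₁ h₂ h₃ h₄
  simp only [ofMul_mul, ofMul_inv] at h₁ h₂ h₃ h₄ ⊢
  linear_combination (norm := module) h₁ - h₂ + h₃ - h₄
end
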